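/- arXiv:1702.07939 — 5 statements merged into one kernel-verified Lean document; each statement's English description precedes it below -/
import Mathlib

section
/- Let q ≥ 2 be an integer and let Π be a (not necessarily Desarguesian) projective plane of order q. Then Π contains a saturating set S with |S| ≤ √((q+1)(3·ln q + ln(ln q) + ln(3/4))) + √(q/(3·ln q)) + 3. -/
/-- A (not necessarily Desarguesian) projective plane of order `q`:
a finite incidence structure of points and lines such that any two distinct
points lie on a unique common line, any two distinct lines meet in a unique
point, there exist four points no three collinear, and every line contains
exactly `q + 1` points. -/
structure ProjPlane (q : ℕ) where
  Point : Type
  Line : Type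
  finite_point : Finite Point
  finite_line : Finite Line
  incid : Point → Line → Prop
  line_unique : ∀ P Q : Point, P ≠ Q → ∃! l : Line, incid P l ∧ incid Q l
  point_unique : ∀ l m : Line, l ≠ m → ∃! P : Point, incid P l ∧ incid P m
  nondeg : ∃ P₁ P₂ P₃ P₄ : Point,
    P₁ ≠ P₂ ∧ P₁ ≠ P₃ ∧ P₁ ≠ P₄ ∧ P₂ ≠ P₃ ∧ P₂ ≠ P₄ ∧ P₃ ≠ P₄ ∧
    (∀ l : Line, ¬(incid P₁ l ∧ incid P₂ l ∧ incid P₃ l)) ∧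
    (∀ l : Line, ¬(incid P₁ l ∧ incid P₂ l ∧ incid P₄ l)) ∧
    (∀ l : Line, ¬(incid P₁ l ∧ incid P₃ l ∧ incid P₄ l)) ∧
    (∀ l : Line, ¬(incid P₂ l ∧ incid P₃ l ∧ incid P₄ l))
  line_card : ∀ l : Line, Nat.card {P : Point // incid P l} = q + 1

/-- A point set `S` is saturating if every point of the plane not in `S`
lies on a line containing at least two points of `S`. -/
def ProjPlane.Saturating {q : ℕ} (PP : ProjPlane q) (S : Set PP.Point) : Prop :=
  ∀ Q : PP.Point, Q ∉ S → ∃ A ∈ S, ∃ B ∈ S, A ≠ B ∧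
    ∃ l : PP.Line, PP.incid A l ∧ PP.incid B l ∧ PP.incid Q l

namespace ProjPlane

open scoped Classical in
/-- The points outside `S` lying on no line that contains two points of `S`. -/
noncomputable def uncovered {q : ℕ} (PP : ProjPlane q) [Fintype PP.Point]
    (S : Finset PP.Point) : Finset PP.Point :=
  {Q | Q ∉ S ∧ ∀ A ∈ S, ∀ B ∈ S, A ≠ B →
    ∀ l : PP.Line, PP.incid A l → PP.incid B l → ¬ PP.incid Q l}

variable {q : ℕ} (PP : ProjPlane q)

theorem line_eq {P Q : PP.Point} {l m : PP.Line} (h : P ≠ Q) (hPl : PP.incid P l)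
    (hQl : PP.incid Q l) (hPm : PP.incid P m) (hQm : PP.incid Q m) : l = m :=
  (PP.line_unique P Q h).unique ⟨hPl, hQl⟩ ⟨hPm, hQm⟩

theorem card_point_eq : Nat.card PP.Point = q ^ 2 + q + 1 := by
  classical
  have := PP.finite_point
  have := PP.finite_line
  have := Fintype.ofFinite PP.Point
  let : Membership PP.Point PP.Line := ⟨fun l P => PP.incid P l⟩
  let : Configuration.ProjectivePlane PP.Point PP.Line :=
    { mkPoint := fun {l₁ l₂} h => (PP.point_unique l₁ l₂ h).choose
      mkPoint_ax := fun {l₁ l₂} h => (PP.point_unique l₁ l₂ h).choose_spec.1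
      mkLine := fun {p₁ p₂} h => (PP.line_unique p₁ p₂ h).choose
      mkLine_ax := fun {p₁ p₂} h => (PP.line_unique p₁ p₂ h).choose_spec.1
      exists_point := by
        intro l
        obtain ⟨P₁, P₂, P₃, -, -, -, -, -, -, -, h123, -⟩ := PP.nondeg
        by_contra! h
        exact h123 l ⟨h P₁, h P₂, h P₃⟩
      exists_line := by
        intro P
        obtain ⟨P₁, P₂, P₃, P₄, -, -, h14, h23, h24, -, -, h124, -, h234⟩ := PP.nondeg
        obtain ⟨l, hl, -⟩ := PP.line_unique P₁ P₄ h14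
        obtain ⟨m, hm, -⟩ := PP.line_unique P₂ P₃ h23
        obtain ⟨n, hn, -⟩ := PP.line_unique P₂ P₄ h24
        by_contra! h
        have hmn : m ≠ n := fun e => h234 m ⟨hm.1, hm.2, e ▸ hn.2⟩
        have hP : P = P₂ := (PP.point_unique m n hmn).unique ⟨h m, h n⟩ ⟨hm.1, hn.1⟩
        exact h124 l ⟨hl.1, hP ▸ h l, hl.2⟩
      eq_or_eq := fun {p₁ p₂ l₁ l₂} h11 h21 h12 h22 =>
        or_iff_not_imp_left.mpr fun h => PP.line_eq h h11 h21 h12 h22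
      exists_config := by
        obtain ⟨P₁, P₂, P₃, P₄, -, -, h14, h23, h24, -, h123, h124, h134, h234⟩ := PP.nondeg
        obtain ⟨l, hl, -⟩ := PP.line_unique P₁ P₄ h14
        obtain ⟨m, hm, -⟩ := PP.line_unique P₂ P₃ h23
        obtain ⟨n, hn, -⟩ := PP.line_unique P₂ P₄ h24
        exact ⟨P₁, P₂, P₃, l, m, n, fun h => h123 m ⟨h, hm⟩, fun h => h124 n ⟨h, hn⟩,
          fun h => h124 l ⟨hl.1, h, hl.2⟩, hm.1, hn.1, fun h => h134 l ⟨hl.1, h, hl.2⟩, hm.2,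
          fun h => h234 n ⟨hn.1, h, hn.2⟩⟩ }
  have hpc : ∀ l : PP.Line, Configuration.pointCount PP.Point l = q + 1 := PP.line_card
  obtain ⟨P₁, P₂, -, -, h12, -⟩ := PP.nondeg
  obtain ⟨l, -, -⟩ := PP.line_unique P₁ P₂ h12
  have ho : Configuration.ProjectivePlane.order PP.Point PP.Line = q := by
    have := Configuration.ProjectivePlane.pointCount_eq PP.Point l
    rw [hpc] at this
    omega
  rw [Nat.card_eq_fintype_card, Configuration.ProjectivePlane.card_points PP.Point PP.Line, ho]

/-- A line together with a point off it is saturating. -/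
theorem exists_saturating_line_insert :
    ∃ S : Set PP.Point, PP.Saturating S ∧ S.ncard ≤ q + 2 := by
  have := PP.finite_point
  obtain ⟨P₁, P₂, P₃, -, h12, h13, -, h23, -, -, h123, -⟩ := PP.nondeg
  obtain ⟨l, ⟨h1, h2⟩, -⟩ := PP.line_unique P₁ P₂ h12
  have h3 : ¬ PP.incid P₃ l := fun h => h123 l ⟨h1, h2, h⟩
  refine ⟨insert P₃ {P | PP.incid P l}, ?_, ?_⟩
  · intro Q hQ
    simp only [Set.mem_insert_iff, Set.mem_ofPred_eq, not_or] at hQ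
    obtain ⟨m, ⟨hm1, hm2⟩, -⟩ := PP.line_unique Q P₃ hQ.1
    have hlm : l ≠ m := fun h => h3 (h ▸ hm2)
    obtain ⟨A, ⟨hA1, hA2⟩, -⟩ := PP.point_unique l m hlm
    exact ⟨P₃, Set.mem_insert _ _, A, Set.mem_insert_of_mem _ hA1, fun h => h3 (h ▸ hA1),
      m, hm2, hA2, hm1⟩
  · refine (Set.ncard_insert_le _ _).trans ?_
    have : ({P | PP.incid P l} : Set PP.Point).ncard = q + 1 := PP.line_card l
    omega

section uncovered

variable [Fintype PP.Point]

theorem mem_uncovered {S : Finset PP.Point} {Q : PP.Point} :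
    Q ∈ PP.uncovered S ↔ Q ∉ S ∧ ∀ A ∈ S, ∀ B ∈ S, A ≠ B →
      ∀ l : PP.Line, PP.incid A l → PP.incid B l → ¬ PP.incid Q l := by
  classical
  simp [uncovered]

theorem uncovered_anti : Antitone PP.uncovered := by
  intro S T h Q hQ
  rw [mem_uncovered] at hQ ⊢
  exact ⟨fun hS => hQ.1 (h hS), fun A hA B hB => hQ.2 A (h hA) B (h hB)⟩

theorem saturating_of_uncovered_eq_empty {S : Finset PP.Point} (h : PP.uncovered S = ∅) :
    PP.Saturating (S : Set PP.Point) := by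
  intro Q hQ
  by_contra hc
  have : Q ∈ PP.uncovered S := by
    rw [mem_uncovered]
    refine ⟨by simpa using hQ, fun A hA B hB hAB l h1 h2 h3 => hc ?_⟩
    exact ⟨A, by simpa using hA, B, by simpa using hB, hAB, l, h1, h2, h3⟩
  simp [h] at this

open scoped Classical in
theorem card_points_on_line (l : PP.Line) :
    (Finset.univ.filter fun P : PP.Point => PP.incid P l).card = q + 1 := by
  rw [← PP.line_card l, Nat.card_eq_fintype_card, Fintype.card_subtype]

/-- Two uncovered points can be covered by adding a single point. -/
theorem exists_point_covering_pair [DecidableEq PP.Point] {S : Finset PP.Point} (hS : 2 ≤ S.card)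
    {Q R : PP.Point} (hQ : Q ∈ PP.uncovered S) (hR : R ∈ PP.uncovered S) :
    ∃ P, Q ∉ PP.uncovered (insert P S) ∧ R ∉ PP.uncovered (insert P S) := by
  obtain ⟨A, hA, B, hB, hAB⟩ := Finset.one_lt_card.mp hS
  rw [mem_uncovered] at hQ hR
  obtain ⟨l, ⟨hQl, hAl⟩, -⟩ := PP.line_unique Q A (fun h => hQ.1 (h ▸ hA))
  obtain ⟨m, ⟨hRm, hBm⟩, -⟩ := PP.line_unique R B (fun h => hR.1 (h ▸ hB))
  have hlm : l ≠ m := fun h => hQ.2 A hA B hB hAB l hAl (h ▸ hBm) hQl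
  obtain ⟨P, ⟨hPl, hPm⟩, -⟩ := PP.point_unique l m hlm
  have hPA : P ≠ A := by
    rintro rfl
    exact hR.2 P hA B hB hAB m hPm hBm hRm
  have hPB : P ≠ B := by
    rintro rfl
    exact hQ.2 A hA P hB hAB l hAl hPl hQl
  refine ⟨P, fun h => ?_, fun h => ?_⟩ <;> rw [mem_uncovered] at h
  · exact h.2 P (Finset.mem_insert_self _ _) A (Finset.mem_insert_of_mem hA) hPA l hPl hAl hQl
  · exact h.2 P (Finset.mem_insert_self _ _) B (Finset.mem_insert_of_mem hB) hPB m hPm hBm hRm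

/-- Any set of at least two points extends to a saturating set by adding about half as many
points as there are uncovered ones. -/
theorem exists_saturating_of_card_uncovered_le (n : ℕ) :
    ∀ S : Finset PP.Point, 2 ≤ S.card → (PP.uncovered S).card ≤ n →
      ∃ T : Finset PP.Point, PP.Saturating (T : Set PP.Point) ∧
        T.card ≤ S.card + (n + 1) / 2 := by
  classical
  induction n using Nat.strong_induction_on with
  | _ n ih =>
    intro S hS hn
    by_cases h0 : PP.uncovered S = ∅
    · exact ⟨S, PP.saturating_of_uncovered_eq_empty h0, by omega⟩
    obtain ⟨Q, hQ⟩ := Finset.nonempty_iff_ne_empty.mpr h0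
    by_cases h1 : (PP.uncovered S).card ≤ 1
    · have hpos : 0 < (PP.uncovered S).card := Finset.card_pos.mpr ⟨Q, hQ⟩
      refine ⟨insert Q S, PP.saturating_of_uncovered_eq_empty ?_, ?_⟩
      · rw [Finset.eq_empty_iff_forall_notMem]
        intro R hR
        have hRQ := Finset.card_le_one.mp h1 R
          (PP.uncovered_anti (Finset.subset_insert Q S) hR) Q hQ
        rw [mem_uncovered, hRQ] at hR
        exact hR.1 (Finset.mem_insert_self _ _)
      · have := Finset.card_insert_le Q S
        omega
    obtain ⟨Q, hQ, R, hR, hQR⟩ := Finset.one_lt_card.mp (not_le.mp h1)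
    obtain ⟨P, hPQ, hPR⟩ := PP.exists_point_covering_pair hS hQ hR
    have hsub : PP.uncovered (insert P S) ⊆ PP.uncovered S \ {Q, R} := by
      intro X hX
      simp only [Finset.mem_sdiff, Finset.mem_insert, Finset.mem_singleton, not_or]
      exact ⟨PP.uncovered_anti (Finset.subset_insert P S) hX,
        fun h => hPQ (h ▸ hX), fun h => hPR (h ▸ hX)⟩
    have hcard := Finset.card_le_card hsub
    rw [Finset.card_sdiff_of_subset (by simp [Finset.insert_subset_iff, hQ, hR]),
      Finset.card_pair hQR] at hcard
    have hle := Finset.card_le_card (Finset.subset_insert P S)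
    obtain ⟨T, hT, hTc⟩ := ih (n - 2) (by omega) (insert P S) (by omega) (by omega)
    refine ⟨T, hT, hTc.trans ?_⟩
    have := Finset.card_insert_le P S
    omega

/-- At least `|S| * (q - 1) + 1` points outside `S` cover a given uncovered point. -/
theorem card_covering_points_ge [DecidableEq PP.Point] {S : Finset PP.Point} {Q : PP.Point}
    (hQ : Q ∈ PP.uncovered S) :
    S.card * (q - 1) + 1 ≤ (Sᶜ.filter fun P => Q ∉ PP.uncovered (insert P S)).card := by
  classical
  have hQ' := PP.mem_uncovered.mp hQ
  have hex : ∀ A, ∃ l : PP.Line, A ∈ S → PP.incid Q l ∧ PP.incid A l := by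
    intro A
    by_cases hA : A ∈ S
    · obtain ⟨l, hl, -⟩ := PP.line_unique Q A (fun h => hQ'.1 (h ▸ hA))
      exact ⟨l, fun _ => hl⟩
    · obtain ⟨P₁, P₂, -, -, h12, -⟩ := PP.nondeg
      obtain ⟨l, -, -⟩ := PP.line_unique P₁ P₂ h12
      exact ⟨l, fun h => absurd h hA⟩
  choose f hf using hex
  let T : PP.Point → Finset PP.Point := fun A =>
    (Finset.univ.filter fun P => PP.incid P (f A)) \ {Q, A}
  have hTcard : ∀ A ∈ S, (T A).card = q - 1 := by
    intro A hA
    have hQA : Q ≠ A := fun h => hQ'.1 (h ▸ hA)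
    rw [Finset.card_sdiff_of_subset, Finset.card_pair hQA, card_points_on_line]
    · omega
    · simp [Finset.insert_subset_iff, hf A hA]
  have hdisj : (S : Set PP.Point).PairwiseDisjoint T := by
    intro A hA B hB hAB
    rw [Function.onFun, Finset.disjoint_left]
    intro P hPA hPB
    simp only [T, Finset.mem_sdiff, Finset.mem_filter, Finset.mem_univ, true_and,
      Finset.mem_insert, Finset.mem_singleton, not_or] at hPA hPB
    have heq : f A = f B :=
      PP.line_eq hPA.2.1 hPA.1 (hf A hA).1 hPB.1 (hf B hB).1
    exact hQ'.2 A hA B hB hAB (f A) (hf A hA).2 (heq ▸ (hf B hB).2) (hf A hA).1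
  have hQT : Q ∉ S.biUnion T := by simp [T]
  have hcard : (insert Q (S.biUnion T)).card = S.card * (q - 1) + 1 := by
    rw [Finset.card_insert_of_notMem hQT, Finset.card_biUnion hdisj, Finset.sum_congr rfl hTcard,
      Finset.sum_const, smul_eq_mul]
  rw [← hcard]
  refine Finset.card_le_card fun P hP => ?_
  rw [Finset.mem_filter, Finset.mem_compl]
  rcases Finset.mem_insert.mp hP with rfl | hP
  · exact ⟨hQ'.1, fun h => (PP.mem_uncovered.mp h).1 (Finset.mem_insert_self _ _)⟩
  · obtain ⟨A, hA, hPA⟩ := Finset.mem_biUnion.mp hP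
    simp only [T, Finset.mem_sdiff, Finset.mem_filter, Finset.mem_univ, true_and,
      Finset.mem_insert, Finset.mem_singleton, not_or] at hPA
    refine ⟨fun hPS => hQ'.2 P hPS A hA hPA.2.2 (f A) hPA.1 (hf A hA).2 (hf A hA).1, fun h => ?_⟩
    exact (PP.mem_uncovered.mp h).2 P (Finset.mem_insert_self _ _) A (Finset.mem_insert_of_mem hA)
      hPA.2.2 (f A) hPA.1 (hf A hA).2 (hf A hA).1

/-- Some point outside `S` covers at least the average number of uncovered points. -/
theorem exists_greedy_point [DecidableEq PP.Point] {S : Finset PP.Point}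
    (hU : (PP.uncovered S).Nonempty) :
    ∃ P ∉ S, (PP.uncovered S).card * (S.card * (q - 1) + 1)
      + (PP.uncovered (insert P S)).card * Sᶜ.card ≤ (PP.uncovered S).card * Sᶜ.card := by
  classical
  by_contra! hc
  obtain ⟨Q, hQ⟩ := hU
  have hne : Sᶜ.Nonempty := ⟨Q, Finset.mem_compl.mpr (PP.mem_uncovered.mp hQ).1⟩
  have hsplit : ∀ P, ((PP.uncovered S).filter fun Q => Q ∉ PP.uncovered (insert P S)).card
      + (PP.uncovered (insert P S)).card = (PP.uncovered S).card := by
    intro P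
    have hsub := PP.uncovered_anti (Finset.subset_insert P S)
    rw [← Finset.card_filter_add_card_filter_not (s := PP.uncovered S)
      (fun Q => Q ∉ PP.uncovered (insert P S))]
    congr 2
    ext X
    simpa using fun h => hsub h
  have hdouble : ∑ P ∈ Sᶜ, ((PP.uncovered S).filter
        fun Q => Q ∉ PP.uncovered (insert P S)).card
      = ∑ Q ∈ PP.uncovered S, (Sᶜ.filter fun P => Q ∉ PP.uncovered (insert P S)).card :=
    Finset.sum_card_bipartiteAbove_eq_sum_card_bipartiteBelow
      (fun P Q => Q ∉ PP.uncovered (insert P S))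
  have hlow : (PP.uncovered S).card * (S.card * (q - 1) + 1)
      ≤ ∑ Q ∈ PP.uncovered S, (Sᶜ.filter fun P => Q ∉ PP.uncovered (insert P S)).card := by
    rw [← smul_eq_mul]
    exact Finset.card_nsmul_le_sum _ _ _ fun Q hQ => PP.card_covering_points_ge hQ
  have hup : (∑ P ∈ Sᶜ, ((PP.uncovered S).filter
        fun Q => Q ∉ PP.uncovered (insert P S)).card) * Sᶜ.card
      < Sᶜ.card * ((PP.uncovered S).card * (S.card * (q - 1) + 1)) := by
    rw [Finset.sum_mul, ← smul_eq_mul (a := Sᶜ.card), ← Finset.sum_const]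
    refine Finset.sum_lt_sum_of_nonempty hne fun P hP => ?_
    have h1 := hc P (Finset.mem_compl.mp hP)
    have h2 := congrArg (· * Sᶜ.card) (hsplit P)
    simp only [add_mul] at h2
    omega
  rw [hdouble, mul_comm] at hup
  exact absurd (Nat.lt_of_mul_lt_mul_left hup) (not_lt.mpr hlow)

/-- The greedy choice of points makes the number of uncovered points decay like a Gaussian in
the number of chosen points. -/
theorem exists_card_uncovered_le (hq : 2 ≤ q) (k : ℕ) (hk : 2 ≤ k) :
    ∃ S : Finset PP.Point, 2 ≤ S.card ∧ S.card ≤ k ∧ (PP.uncovered S = ∅ ∨ (S.card = k ∧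
      ((PP.uncovered S).card : ℝ) ≤
        q ^ 2 * Real.exp (-((q - 1) / (q ^ 2 + q + 1) * (k * (k - 1) / 2 - 1))))) := by
  classical
  have hN : Fintype.card PP.Point = q ^ 2 + q + 1 := by
    rw [← Nat.card_eq_fintype_card, card_point_eq]
  induction k, hk using Nat.le_induction with
  | base =>
    obtain ⟨A, B, -, -, hAB, -⟩ := PP.nondeg
    obtain ⟨l, ⟨hA, hB⟩, -⟩ := PP.line_unique A B hAB
    refine ⟨{A, B}, by rw [Finset.card_pair hAB], by rw [Finset.card_pair hAB],
      Or.inr ⟨Finset.card_pair hAB, ?_⟩⟩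
    have hsub : PP.uncovered {A, B} ⊆ (Finset.univ.filter fun P => PP.incid P l)ᶜ := by
      intro Q hQ
      simp only [Finset.mem_compl, Finset.mem_filter, Finset.mem_univ, true_and]
      exact (PP.mem_uncovered.mp hQ).2 A (by simp) B (by simp) hAB l hA hB
    have hcard := Finset.card_le_card hsub
    rw [Finset.card_compl, card_points_on_line, hN] at hcard
    have : (PP.uncovered {A, B}).card ≤ q ^ 2 := by omega
    have h2 : ((PP.uncovered {A, B}).card : ℝ) ≤ (q : ℝ) ^ 2 := by exact_mod_cast this
    norm_num
    exact h2
  | succ k hk ih =>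
    obtain ⟨S, hS2, hSk, hS⟩ := ih
    by_cases h0 : PP.uncovered S = ∅
    · exact ⟨S, hS2, by omega, Or.inl h0⟩
    obtain ⟨hSc, hle⟩ := hS.resolve_left h0
    obtain ⟨P, hPS, hP⟩ := PP.exists_greedy_point (Finset.nonempty_iff_ne_empty.mpr h0)
    have hins : (insert P S).card = k + 1 := by rw [Finset.card_insert_of_notMem hPS, hSc]
    refine ⟨insert P S, by omega, by omega, Or.inr ⟨hins, ?_⟩⟩
    have hcpos : 0 < Sᶜ.card := Finset.card_pos.mpr ⟨P, Finset.mem_compl.mpr hPS⟩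
    have hcN : Sᶜ.card ≤ q ^ 2 + q + 1 := hN ▸ Finset.card_le_univ _
    rw [hSc] at hP
    have hPR : ((PP.uncovered S).card : ℝ) * (k * (q - 1) + 1)
        + (PP.uncovered (insert P S)).card * (Sᶜ.card : ℝ)
        ≤ (PP.uncovered S).card * (Sᶜ.card : ℝ) := by
      have := (Nat.cast_le (α := ℝ)).mpr hP
      push_cast [Nat.cast_sub (show 1 ≤ q by omega)] at this
      exact this
    set u : ℝ := ((PP.uncovered S).card : ℝ)
    set v : ℝ := ((PP.uncovered (insert P S)).card : ℝ)
    have hc : (0 : ℝ) < Sᶜ.card := by exact_mod_cast hcpos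
    have hcN' : (Sᶜ.card : ℝ) ≤ q ^ 2 + q + 1 := by exact_mod_cast hcN
    set c : ℝ := (Sᶜ.card : ℝ)
    have hq1 : (0 : ℝ) ≤ q - 1 := by
      have : (2 : ℝ) ≤ q := by exact_mod_cast hq
      linarith
    have hu : 0 ≤ u := Nat.cast_nonneg _
    set x : ℝ := (q - 1) / (q ^ 2 + q + 1) * k with hx
    have hxc : x * c ≤ k * (q - 1) + 1 := by
      have : x * c ≤ x * (q ^ 2 + q + 1) := by gcongr
      have h2 : x * ((q : ℝ) ^ 2 + q + 1) = (q - 1) * k := by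
        rw [hx]; field_simp
      linarith
    have hv : v ≤ u * (1 - x) := by
      refine le_of_mul_le_mul_right ?_ hc
      have : u * (x * c) ≤ u * (k * (q - 1) + 1) := by gcongr
      linarith
    calc v ≤ u * (1 - x) := hv
      _ ≤ u * Real.exp (-x) := by
        gcongr
        have := Real.add_one_le_exp (-x)
        linarith
      _ ≤ _ := mul_le_mul_of_nonneg_right hle (Real.exp_pos _).le
      _ = _ := by
        rw [mul_assoc, ← Real.exp_add, hx]
        congr 2
        push_cast
        ring

end uncovered

end ProjPlane

/-- The parameter `2 * √(q / (3 * log q))` is the value of `q ^ 2 * exp (-x / 2)` at the constant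
under the main root of the bound. -/
theorem sq_mul_exp_neg_half_eq {q : ℝ} (hq : 1 < q) :
    q ^ 2 * Real.exp (-((3 * Real.log q + Real.log (Real.log q) + Real.log (3 / 4)) / 2))
      = 2 * Real.sqrt (q / (3 * Real.log q)) := by
  have hL : 0 < Real.log q := Real.log_pos hq
  have hq0 : 0 < q := by linarith
  refine (sq_eq_sq₀ (by positivity) (by positivity)).mp ?_
  rw [mul_pow, mul_pow, Real.sq_sqrt (by positivity), ← Real.exp_nat_mul]
  have : ((2 : ℕ) : ℝ) * -((3 * Real.log q + Real.log (Real.log q) + Real.log (3 / 4)) / 2)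
      = -(Real.log (q ^ 3 * Real.log q * (3 / 4))) := by
    rw [Real.log_mul (by positivity) (by norm_num), Real.log_mul (by positivity) hL.ne',
      Real.log_pow]
    push_cast
    ring
  rw [this, Real.exp_neg, Real.exp_log (by positivity)]
  field_simp
  norm_num

theorem log_three_quarters_mem_Icc : Real.log (3 / 4) ∈ Set.Icc (-(1 / 3) : ℝ) (-(1 / 4)) := by
  constructor
  · have := Real.one_sub_inv_le_log_of_pos (show (0 : ℝ) < 3 / 4 by norm_num)
    norm_num at this ⊢
    linarith
  · have := Real.log_le_sub_one_of_pos (show (0 : ℝ) < 3 / 4 by norm_num)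
    norm_num at this ⊢
    linarith

theorem saturating_log_factor_upper {q : ℝ} (hq : 6 ≤ q) :
    (q + 1) * (3 * Real.log q + Real.log (Real.log q) + Real.log (3 / 4))
      ≤ (11 / 10 * q) ^ 2 := by
  have hL : 0 < Real.log q := Real.log_pos (by linarith)
  have h34 := log_three_quarters_mem_Icc.2
  have h2 := Real.log_two_lt_d9
  have hq8 : Real.log q ≤ 3 * Real.log 2 + (q / 8 - 1) := by
    have := Real.log_le_sub_one_of_pos (show 0 < q / 8 by linarith)
    rw [Real.log_div (by linarith) (by norm_num), show (8 : ℝ) = 2 ^ 3 by norm_num,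
      Real.log_pow] at this
    push_cast at this
    linarith
  have hLL : Real.log (Real.log q) ≤ Real.log 2 + (Real.log q / 2 - 1) := by
    have := Real.log_le_sub_one_of_pos (show 0 < Real.log q / 2 by linarith)
    rw [Real.log_div hL.ne' (by norm_num)] at this
    linarith
  have hE : 3 * Real.log q + Real.log (Real.log q) + Real.log (3 / 4)
      ≤ 7 / 16 * q + 323 / 100 := by linarith
  nlinarith

theorem two_le_saturating_log_factor {q : ℝ} (hq : 3 ≤ q) :
    2 ≤ 3 * Real.log q + Real.log (Real.log q) + Real.log (3 / 4) := by
  have hL : 1 ≤ Real.log q := by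
    rw [Real.le_log_iff_exp_le (by linarith)]
    linarith [Real.exp_one_lt_d9]
  have := Real.log_nonneg hL
  linarith [log_three_quarters_mem_Icc.1]

/-- For small orders the bound exceeds the size of a line together with a point. -/
theorem sub_one_sq_le_of_le_five {q : ℕ} (hq : 2 ≤ q) (hq5 : q ≤ 5) :
    ((q : ℝ) - 1) ^ 2 ≤ (q + 1) * (3 * Real.log q + Real.log (Real.log q)
      + Real.log (3 / 4)) := by
  have h34 := log_three_quarters_mem_Icc.1
  have h2 := Real.log_two_gt_d9
  rcases hq.eq_or_lt with rfl | h3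
  · have hl2 : -(1 / 2) ≤ Real.log (Real.log 2) := by
      have h := Real.one_sub_inv_le_log_of_pos (show 0 < Real.log 2 by linarith)
      have : (Real.log 2)⁻¹ ≤ 3 / 2 := by
        rw [inv_le_comm₀ (by linarith) (by norm_num)]
        linarith
      linarith
    push_cast
    linarith
  · have h3' : (3 : ℝ) ≤ q := by exact_mod_cast h3
    have hq5' : (q : ℝ) ≤ 5 := by exact_mod_cast hq5
    have hL : 1 ≤ Real.log q := by
      rw [Real.le_log_iff_exp_le (by linarith)]
      linarith [Real.exp_one_lt_d9]
    have := Real.log_nonneg hL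
    have hE : (8 / 3 : ℝ) ≤ 3 * Real.log q + Real.log (Real.log q) + Real.log (3 / 4) := by
      linarith
    nlinarith

/-- Choosing slightly more than `K` points compensates for the lower order terms in the decay
rate. -/
theorem half_sq_div_le_decay_exponent {q K k : ℝ} (hq : 6 ≤ q) (hK1 : 1 ≤ K)
    (hK : K ≤ 11 / 10 * q) (hk : K + 3 / 2 ≤ k) :
    K ^ 2 / (q + 1) / 2 ≤ (q - 1) / (q ^ 2 + q + 1) * (k * (k - 1) / 2 - 1) := by
  have h1 : K ^ 2 + 2 * K - 5 / 4 ≤ k * (k - 1) - 2 := by nlinarith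
  have h2 : K ^ 2 * (q + 2) ≤ (q ^ 2 - 1) * (2 * K - 5 / 4) := by
    have : (K - 1) * (11 / 10 * q - K) ≥ 0 :=
      mul_nonneg (by linarith) (by linarith)
    nlinarith [mul_nonneg this (show 0 ≤ q + 2 by linarith),
      mul_nonneg (sub_nonneg.mpr hK1) (show 0 ≤ q - 6 by linarith),
      mul_nonneg (mul_nonneg (sub_nonneg.mpr hK1) (show 0 ≤ q - 6 by linarith))
        (show 0 ≤ q - 6 by linarith)]
  rw [div_div, div_mul_eq_mul_div, div_le_div_iff₀ (by linarith) (by positivity)]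
  have h3 := mul_le_mul_of_nonneg_left h1 (show 0 ≤ q ^ 2 - 1 by nlinarith)
  nlinarith

theorem smallest_saturating_set_bound (q : ℕ) (hq : 2 ≤ q) (PP : ProjPlane q) :
    ∃ S : Set PP.Point, PP.Saturating S ∧
      (S.ncard : ℝ) ≤ Real.sqrt ((q + 1) * (3 * Real.log q + Real.log (Real.log q)
        + Real.log (3 / 4))) + Real.sqrt (q / (3 * Real.log q)) + 3 := by
  classical
  rcases le_or_gt q 5 with h5 | h6
  · obtain ⟨S, hS, hSc⟩ := PP.exists_saturating_line_insert
    refine ⟨S, hS, ?_⟩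
    have h1 := Real.le_sqrt_of_sq_le (sub_one_sq_le_of_le_five hq h5)
    have h2 := Real.sqrt_nonneg ((q : ℝ) / (3 * Real.log q))
    have h3 : (S.ncard : ℝ) ≤ q + 2 := by exact_mod_cast hSc
    linarith
  have := PP.finite_point
  have := Fintype.ofFinite PP.Point
  have h6' : (6 : ℝ) ≤ q := by exact_mod_cast h6
  have hE := two_le_saturating_log_factor (show (3 : ℝ) ≤ q by linarith)
  have hupper := saturating_log_factor_upper h6'
  have hexp := sq_mul_exp_neg_half_eq (show (1 : ℝ) < q by linarith)
  set E : ℝ := 3 * Real.log q + Real.log (Real.log q) + Real.log (3 / 4)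
  set R : ℝ := Real.sqrt (q / (3 * Real.log q))
  set K : ℝ := Real.sqrt ((q + 1) * E)
  have hKsq : K ^ 2 = (q + 1) * E := Real.sq_sqrt (by positivity)
  have hK1 : 1 ≤ K := Real.le_sqrt_of_sq_le (by nlinarith)
  have hK : K ≤ 11 / 10 * q := Real.sqrt_le_iff.mpr ⟨by positivity, hupper⟩
  set k : ℕ := ⌈K + 3 / 2⌉₊
  have hk : K + 3 / 2 ≤ k := Nat.le_ceil _
  have hk' : (k : ℝ) < K + 3 / 2 + 1 := Nat.ceil_lt_add_one (by linarith)
  have hk2 : 2 ≤ k := by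
    have : (2 : ℝ) ≤ k := by linarith
    exact_mod_cast this
  obtain ⟨S, hS2, hSk, hS⟩ := PP.exists_card_uncovered_le hq k hk2
  have hU : ((PP.uncovered S).card : ℝ) ≤ 2 * R := by
    rcases hS with h0 | ⟨-, h⟩
    · rw [h0, Finset.card_empty, Nat.cast_zero]
      positivity
    · refine h.trans (hexp ▸ ?_)
      have hdecay := half_sq_div_le_decay_exponent h6' hK1 hK hk
      rw [hKsq, mul_div_cancel_left₀ E (by positivity)] at hdecay
      gcongr
  obtain ⟨T, hT, hTc⟩ := PP.exists_saturating_of_card_uncovered_le _ S hS2 le_rfl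
  refine ⟨T, hT, ?_⟩
  rw [Set.ncard_coe_finset]
  have h2T : 2 * T.card ≤ 2 * k + ((PP.uncovered S).card + 1) := by omega
  have h2T' : 2 * (T.card : ℝ) ≤ 2 * k + ((PP.uncovered S).card + 1) := by exact_mod_cast h2T
  linarith
end

section
/- Let q ≥ 2 be an integer, let Π be a projective plane of order q, and let ξ ≥ 1 be a real number. Then Π contains a saturating set S with |S| ≤ √(2(q+1))·√(ln(q²/ξ)) + ξ/2 + 3. -/
/-- `R(T)`: the set of points of the plane not in `T` that do not lie on any
line containing at least two points of `T` (the points not covered by `T`). -/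
def ProjPlane.uncov {q : ℕ} (PP : ProjPlane q) (T : Set PP.Point) : Set PP.Point :=
  {Q : PP.Point | Q ∉ T ∧ ¬ ∃ A ∈ T, ∃ B ∈ T, A ≠ B ∧
    ∃ l : PP.Line, PP.incid A l ∧ PP.incid B l ∧ PP.incid Q l}

theorem Finset.exists_sum_le_card_mul {ι : Type*} {s : Finset ι} (hs : s.Nonempty) (f : ι → ℕ) :
    ∃ i ∈ s, ∑ j ∈ s, f j ≤ s.card * f i := by
  obtain ⟨i, hi, hmax⟩ := s.exists_max_image f hs
  exact ⟨i, hi, by simpa using Finset.sum_le_card_nsmul s f (f i) hmax⟩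

namespace ProjPlane

variable {q : ℕ} (PP : ProjPlane q)

instance : Finite PP.Point := PP.finite_point

instance : Finite PP.Line := PP.finite_line

noncomputable instance : Fintype PP.Point := Fintype.ofFinite _

noncomputable instance : Fintype PP.Line := Fintype.ofFinite _

instance : Membership PP.Point PP.Line := ⟨fun l P => PP.incid P l⟩

theorem exists_line_through (A B : PP.Point) (h : A ≠ B) : ∃ l : PP.Line, A ∈ l ∧ B ∈ l :=
  (PP.line_unique A B h).exists

theorem eq_or_eq_of_mem {A B : PP.Point} {l m : PP.Line} (hAl : A ∈ l) (hBl : B ∈ l)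
    (hAm : A ∈ m) (hBm : B ∈ m) : A = B ∨ l = m :=
  or_iff_not_imp_left.mpr fun h => (PP.line_unique A B h).unique ⟨hAl, hBl⟩ ⟨hAm, hBm⟩

/-- The plane as a projective plane in the sense of `Configuration.ProjectivePlane`. -/
noncomputable instance : Configuration.ProjectivePlane PP.Point PP.Line where
  exists_point l := by
    obtain ⟨P₁, P₂, P₃, P₄, -, -, -, -, -, -, h, -⟩ := PP.nondeg
    by_contra! hl
    exact h l ⟨hl P₁, hl P₂, hl P₃⟩
  exists_line P := by
    obtain ⟨P₁, P₂, P₃, P₄, h₁₂, h₁₃, h₁₄, h₂₃, -, -, h, -⟩ := PP.nondeg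
    by_contra! hP
    obtain ⟨l, h₁, h₂⟩ := PP.exists_line_through P₁ P₂ h₁₂
    obtain ⟨m, h₁', h₃⟩ := PP.exists_line_through P₁ P₃ h₁₃
    obtain ⟨n, h₂', h₃'⟩ := PP.exists_line_through P₂ P₃ h₂₃
    rcases PP.eq_or_eq_of_mem h₁ (hP l) h₁' (hP m) with rfl | rfl
    · rcases PP.eq_or_eq_of_mem h₂ (hP l) h₂' (hP n) with rfl | rfl
      · exact h₁₂ rfl
      · exact h l ⟨h₁, h₂, h₃'⟩
    · exact h l ⟨h₁, h₂, h₃⟩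
  eq_or_eq := PP.eq_or_eq_of_mem
  mkPoint h := (PP.point_unique _ _ h).choose
  mkPoint_ax h := (PP.point_unique _ _ h).choose_spec.1
  mkLine h := (PP.line_unique _ _ h).choose
  mkLine_ax h := (PP.line_unique _ _ h).choose_spec.1
  exists_config := by
    obtain ⟨P₁, P₂, P₃, P₄, -, -, h₁₄, h₂₃, h₂₄, -, h₁₂₃, h₁₂₄, h₁₃₄, h₂₃₄⟩ := PP.nondeg
    obtain ⟨l, hl, hl'⟩ := PP.exists_line_through P₁ P₄ h₁₄
    obtain ⟨m, hm, hm'⟩ := PP.exists_line_through P₂ P₃ h₂₃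
    obtain ⟨n, hn, hn'⟩ := PP.exists_line_through P₂ P₄ h₂₄
    exact ⟨P₁, P₂, P₃, l, m, n, fun k => h₁₂₃ m ⟨k, hm, hm'⟩, fun k => h₁₂₄ n ⟨k, hn, hn'⟩,
      fun k => h₁₂₄ l ⟨hl, k, hl'⟩, hm, hn, fun k => h₁₃₄ l ⟨hl, k, hl'⟩, hm',
      fun k => h₂₃₄ n ⟨hn, k, hn'⟩⟩

theorem order_eq : Configuration.ProjectivePlane.order PP.Point PP.Line = q := by
  obtain ⟨-, -, -, l, -⟩ :=
    Configuration.ProjectivePlane.exists_config (P := PP.Point) (L := PP.Line)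
  have h := Configuration.ProjectivePlane.pointCount_eq PP.Point l
  have h' : Configuration.pointCount PP.Point l = q + 1 := PP.line_card l
  omega

theorem card_point : Fintype.card PP.Point = q ^ 2 + q + 1 := by
  rw [Configuration.ProjectivePlane.card_points PP.Point PP.Line, order_eq]

theorem exists_mem_mem (l m : PP.Line) (h : l ≠ m) : ∃ P : PP.Point, P ∈ l ∧ P ∈ m :=
  (PP.point_unique l m h).exists

open scoped Classical in
theorem card_filter_mem_line (l : PP.Line) :
    (Finset.univ.filter fun P : PP.Point => P ∈ l).card = q + 1 := by
  rw [← PP.line_card l, Nat.card_eq_fintype_card, Fintype.card_subtype]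
  rfl

open scoped Classical in
theorem card_filter_line_through (P : PP.Point) :
    (Finset.univ.filter fun l : PP.Line => P ∈ l).card = q + 1 := by
  have h := Configuration.ProjectivePlane.lineCount_eq PP.Line P
  rwa [Configuration.lineCount, order_eq, Nat.card_eq_fintype_card, Fintype.card_subtype] at h

variable {PP}

theorem eq_of_mem_uncov {T : Set PP.Point} {Q A B : PP.Point} {l : PP.Line} (hQ : Q ∈ PP.uncov T)
    (hA : A ∈ T) (hB : B ∈ T) (hAl : A ∈ l) (hBl : B ∈ l) (hQl : Q ∈ l) : A = B := by
  by_contra h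
  exact hQ.2 ⟨A, hA, B, hB, h, l, hAl, hBl, hQl⟩

theorem ne_of_mem_uncov {T : Set PP.Point} {Q A : PP.Point} (hQ : Q ∈ PP.uncov T) (hA : A ∈ T) :
    Q ≠ A :=
  fun h => hQ.1 (h ▸ hA)

theorem notMem_uncov_insert {T : Set PP.Point} {P Q B : PP.Point} {l : PP.Line} (hB : B ∈ T)
    (hPB : P ≠ B) (hPl : P ∈ l) (hBl : B ∈ l) (hQl : Q ∈ l) : Q ∉ PP.uncov (insert P T) :=
  fun h => h.2 ⟨P, Set.mem_insert _ _, B, Set.mem_insert_of_mem _ hB, hPB, l, hPl, hBl, hQl⟩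

theorem uncov_anti {T U : Set PP.Point} (h : T ⊆ U) : PP.uncov U ⊆ PP.uncov T := by
  rintro Q ⟨hQ, hQ'⟩
  refine ⟨fun k => hQ (h k), ?_⟩
  rintro ⟨A, hA, B, hB, r⟩
  exact hQ' ⟨A, h hA, B, h hB, r⟩

theorem saturating_iff_uncov_eq_empty {T : Set PP.Point} : PP.Saturating T ↔ PP.uncov T = ∅ := by
  simp only [Saturating, Set.eq_empty_iff_forall_notMem, uncov, Set.mem_ofPred_eq, not_and, not_not]

open scoped Classical in
/-- A set `T` leaving a point `Q` uncovered has at most one point on each line through `Q`. -/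
theorem card_le_of_mem_uncov {T : Finset PP.Point} {Q : PP.Point} (hQ : Q ∈ PP.uncov ↑T) :
    T.card ≤ q + 1 := by
  rw [← PP.card_filter_line_through Q]
  have h (B : PP.Point) : ∃ l : PP.Line, B ∈ T → Q ∈ l ∧ B ∈ l := by
    by_cases hB : B ∈ T
    · obtain ⟨l, hl⟩ := PP.exists_line_through Q B (ne_of_mem_uncov hQ hB)
      exact ⟨l, fun _ => hl⟩
    · obtain ⟨l, -⟩ := Configuration.Nondegenerate.exists_line (L := PP.Line) B
      exact ⟨l, fun h => absurd h hB⟩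
  choose f hf using h
  refine Finset.card_le_card_of_injOn f (fun B hB => by simpa using (hf B hB).1) ?_
  intro A hA B hB hAB
  have hB' := hf B hB
  rw [← hAB] at hB'
  exact eq_of_mem_uncov hQ hA hB (hf A hA).2 hB'.2 hB'.1

open scoped Classical in
/-- Some line through a given point of `T` carries at least the average number of points not
covered by `T`. -/
theorem exists_line_card_uncov_le {T : Finset PP.Point} {A : PP.Point} (hA : A ∈ T) :
    ∃ l : PP.Line, A ∈ l ∧ (PP.uncov ↑T).toFinset.card ≤
      (q + 1) * ((PP.uncov ↑T).toFinset.filter fun Q => Q ∈ l).card := by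
  have hne : (Finset.univ.filter fun l : PP.Line => A ∈ l).Nonempty := by
    rw [← Finset.card_pos, card_filter_line_through]; omega
  obtain ⟨l, hl, h⟩ := Finset.exists_sum_le_card_mul hne
    fun l => ((PP.uncov ↑T).toFinset.filter fun Q => Q ∈ l).card
  rw [card_filter_line_through] at h
  refine ⟨l, by simpa using hl, le_trans ?_ h⟩
  refine le_trans (Finset.card_le_card fun Q hQ => ?_) Finset.card_biUnion_le
  obtain ⟨m, hm, hm'⟩ := PP.exists_line_through Q A (ne_of_mem_uncov (by simpa using hQ) hA)
  simp only [Finset.mem_biUnion, Finset.mem_filter, Finset.mem_univ, true_and]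
  exact ⟨m, hm', hQ, hm⟩

open scoped Classical in
/-- The points of a tangent line `l` at `A ∈ T` which, added to `T`, cover a given point `Q` off
the line. -/
theorem card_le_card_filter_covering {T : Finset PP.Point} {A Q : PP.Point} {l : PP.Line}
    (hA : A ∈ T) (htan : ∀ B ∈ T, B ∈ l → B = A) (hQ : Q ∈ PP.uncov ↑T)
    (hQl : Q ∉ l) :
    T.card - 1 ≤ ((Finset.univ.filter fun P : PP.Point => P ∈ l ∧ P ≠ A).filter
      fun P => Q ∉ PP.uncov (insert P ↑T)).card := by
  rw [← Finset.card_erase_of_mem hA]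
  have h (B : PP.Point) : ∃ P : PP.Point, B ∈ T.erase A →
      P ∈ l ∧ ∃ m : PP.Line, Q ∈ m ∧ B ∈ m ∧ P ∈ m := by
    by_cases hB : B ∈ T
    · obtain ⟨m, hm⟩ := PP.exists_line_through Q B (ne_of_mem_uncov hQ hB)
      obtain ⟨P, hP⟩ := PP.exists_mem_mem l m (by rintro rfl; exact hQl hm.1)
      exact ⟨P, fun _ => ⟨hP.1, m, hm.1, hm.2, hP.2⟩⟩
    · exact ⟨A, fun h => absurd (Finset.mem_of_mem_erase h) hB⟩
  choose f hf using h
  refine Finset.card_le_card_of_injOn f ?_ ?_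
  · intro B hB
    obtain ⟨hPl, m, hQm, hBm, hPm⟩ := hf B hB
    have hBT := Finset.mem_of_mem_erase hB
    have hBA := Finset.ne_of_mem_erase hB
    simp only [Finset.coe_filter, Finset.mem_filter, Finset.mem_univ, true_and, Set.mem_ofPred_eq]
    refine ⟨⟨hPl, fun h => hBA ?_⟩, notMem_uncov_insert hBT (fun h => hBA ?_) hPm hBm hQm⟩
    · exact eq_of_mem_uncov hQ hBT hA hBm (h ▸ hPm) hQm
    · exact htan B hBT (h ▸ hPl)
  · intro B hB C hC hBC
    obtain ⟨hPl, m, hQm, hBm, hPm⟩ := hf B hB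
    obtain ⟨-, n, hQn, hCn, hPn⟩ := hf C hC
    rw [← hBC] at hPn
    rcases PP.eq_or_eq_of_mem hQm hPm hQn hPn with h | rfl
    · exact absurd (h ▸ hPl) hQl
    · exact eq_of_mem_uncov hQ (Finset.mem_of_mem_erase hB) (Finset.mem_of_mem_erase hC) hBm hCn hQm

theorem greedy_count_bound {q k r a b u c : ℕ} (hq : 0 < q) (hk : 0 < k) (hkq : k ≤ q + 1)
    (hr : r ≤ (q + 1) * a) (hab : a + b = r) (huc : u + c = r)
    (htot : q * a + (k - 1) * b ≤ q * c) : (q + 1) * u + k * r ≤ (q + 1) * r := by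
  obtain ⟨j, rfl⟩ : ∃ j, k = j + 1 := ⟨k - 1, by omega⟩
  obtain ⟨d, rfl⟩ : ∃ d, q = j + d := ⟨q - j, by omega⟩
  rw [Nat.add_sub_cancel] at htot
  suffices (j + 1) * r ≤ (j + d + 1) * c by rw [← huc] at this ⊢; linarith
  refine Nat.le_of_mul_le_mul_left ?_ hq
  subst hab
  have h₁ := Nat.mul_le_mul_left (j + d + 1) htot
  have h₂ := Nat.mul_le_mul_left d hr
  linarith

open scoped Classical in
/-- The greedy step: some point covers at least a `|T| / (q + 1)` fraction of the points not
covered by `T`. -/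
theorem exists_insert_card_uncov_le (hq : 0 < q) {T : Finset PP.Point} (hT : T.Nonempty)
    (hR : (PP.uncov ↑T).Nonempty) :
    ∃ P ∉ T, (q + 1) * (PP.uncov (insert P ↑T)).toFinset.card + T.card * (PP.uncov ↑T).toFinset.card
      ≤ (q + 1) * (PP.uncov ↑T).toFinset.card := by
  obtain ⟨Q₀, hQ₀⟩ := hR
  obtain ⟨A, hA⟩ := hT
  have hk := card_le_of_mem_uncov hQ₀
  have hk' := Finset.card_pos.mpr ⟨A, hA⟩
  obtain ⟨l, hAl, hl⟩ := exists_line_card_uncov_le hA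
  set R := (PP.uncov ↑T).toFinset with hRdef
  have hRpos : 0 < R.card := Finset.card_pos.mpr ⟨Q₀, by simpa [hRdef] using hQ₀⟩
  have hRl : 0 < (R.filter fun Q => Q ∈ l).card := Nat.pos_of_mul_pos_left (hRpos.trans_le hl)
  obtain ⟨Q₁, hQ₁⟩ := Finset.card_pos.mp hRl
  simp only [Finset.mem_filter, hRdef, Set.mem_toFinset] at hQ₁
  have htan : ∀ B ∈ T, B ∈ l → B = A := fun B hB hBl =>
    eq_of_mem_uncov hQ₁.1 hB hA hBl hAl hQ₁.2
  let M := Finset.univ.filter fun P : PP.Point => P ∈ l ∧ P ≠ A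
  have hM : M.card = q := by
    have : M = (Finset.univ.filter fun P : PP.Point => P ∈ l).erase A := by
      ext P; simp [M, and_comm]
    rw [this, Finset.card_erase_of_mem (by simpa using hAl), card_filter_mem_line]
    rfl
  have hMT : ∀ P ∈ M, P ∉ T := fun P hP hPT => by
    simp only [M, Finset.mem_filter] at hP
    exact hP.2.2 (htan P hPT hP.2.1)
  obtain ⟨P, hP, hPle⟩ := Finset.exists_sum_le_card_mul (Finset.card_pos.mp (hM ▸ hq))
    fun P => (R.filter fun Q => Q ∉ PP.uncov (insert P ↑T)).card
  have hcount : q * (R.filter fun Q => Q ∈ l).card + (T.card - 1) * (R.filter fun Q => Q ∉ l).card ≤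
      ∑ P ∈ M, (R.filter fun Q => Q ∉ PP.uncov (insert P ↑T)).card := by
    have hswap := Finset.sum_card_bipartiteAbove_eq_sum_card_bipartiteBelow
      (s := M) (t := R) fun P Q => Q ∉ PP.uncov (insert P ↑T)
    simp only [Finset.bipartiteAbove, Finset.bipartiteBelow] at hswap
    rw [hswap, ← Finset.sum_filter_add_sum_filter_not R fun Q => Q ∈ l]
    refine add_le_add ?_ ?_
    · rw [mul_comm, ← smul_eq_mul]
      refine Finset.card_nsmul_le_sum _ _ _ fun Q hQ => ?_
      refine hM.symm.trans_le (Finset.card_le_card fun P hP => Finset.mem_filter.mpr ⟨hP, ?_⟩)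
      simp only [M, Finset.mem_filter] at hP hQ
      exact notMem_uncov_insert hA hP.2.2 hP.2.1 hAl hQ.2
    · rw [mul_comm, ← smul_eq_mul]
      refine Finset.card_nsmul_le_sum _ _ _ fun Q hQ => ?_
      simp only [Finset.mem_filter, hRdef, Set.mem_toFinset] at hQ
      exact card_le_card_filter_covering hA htan hQ.1 hQ.2
  refine ⟨P, hMT P hP, ?_⟩
  have hsub : (PP.uncov (insert P ↑T)).toFinset =
      R.filter fun Q => Q ∈ PP.uncov (insert P ↑T) := by
    ext Q
    simp only [hRdef, Set.mem_toFinset, Finset.mem_filter]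
    exact ⟨fun h => ⟨uncov_anti (Set.subset_insert _ _) h, h⟩, fun h => h.2⟩
  have hsplit := Finset.card_filter_add_card_filter_not (s := R)
    fun Q => Q ∈ PP.uncov (insert P ↑T)
  have hsplit' := Finset.card_filter_add_card_filter_not (s := R) fun Q => Q ∈ l
  rw [hsub]
  rw [hM] at hPle
  have htot := hcount.trans hPle
  exact greedy_count_bound hq hk' hk hl hsplit' hsplit htot

open scoped Classical in
/-- A set of at least two points can be made saturating by adding one point for every two points
not covered. -/
theorem exists_saturating_card_le (T : Finset PP.Point) (hT : 1 < T.card) :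
    ∃ S : Finset PP.Point, PP.Saturating ↑S ∧
      S.card ≤ T.card + ((PP.uncov ↑T).toFinset.card + 1) / 2 := by
  induction hr : (PP.uncov (T : Set PP.Point)).toFinset.card using Nat.strong_induction_on
    generalizing T with
  | _ r ih =>
  rcases Nat.lt_or_ge 1 r with h | h
  · obtain ⟨Q, hQ, Q', hQ', hne⟩ := Finset.one_lt_card.mp (hr ▸ h)
    obtain ⟨A, hA, B, hB, hAB⟩ := Finset.one_lt_card.mp hT
    have hQu := Set.mem_toFinset.mp hQ
    have hQu' := Set.mem_toFinset.mp hQ'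
    obtain ⟨l, hQl, hAl⟩ := PP.exists_line_through Q A (ne_of_mem_uncov hQu hA)
    obtain ⟨m, hQm, hBm⟩ := PP.exists_line_through Q' B (ne_of_mem_uncov hQu' hB)
    obtain ⟨P, hPl, hPm⟩ := PP.exists_mem_mem l m
      (by rintro rfl; exact hAB (eq_of_mem_uncov hQu hA hB hAl hBm hQl))
    have hPA : P ≠ A := by
      rintro rfl; exact hAB (eq_of_mem_uncov hQu' hA hB hPm hBm hQm)
    have hPB : P ≠ B := by
      rintro rfl; exact hAB (eq_of_mem_uncov hQu hA hB hAl hPl hQl)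
    have hsub : (PP.uncov ↑(insert P T)).toFinset ⊆
        (((PP.uncov (T : Set PP.Point)).toFinset.erase Q).erase Q') := by
      intro X hX
      rw [Set.mem_toFinset, Finset.coe_insert] at hX
      refine Finset.mem_erase.mpr ⟨?_, Finset.mem_erase.mpr ⟨?_, Set.mem_toFinset.mpr
        (uncov_anti (Set.subset_insert _ _) hX)⟩⟩
      · rintro rfl; exact notMem_uncov_insert hB hPB hPm hBm hQm hX
      · rintro rfl; exact notMem_uncov_insert hA hPA hPl hAl hQl hX
    have hcard := Finset.card_le_card hsub
    rw [Finset.card_erase_of_mem (Finset.mem_erase.mpr ⟨hne.symm, hQ'⟩),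
      Finset.card_erase_of_mem hQ, hr] at hcard
    have hmono := Finset.card_le_card (Finset.subset_insert P T)
    obtain ⟨S, hS, hS'⟩ := ih _ (by omega) (insert P T) (by omega) rfl
    have := Finset.card_insert_le P T
    exact ⟨S, hS, by omega⟩
  · refine ⟨T ∪ (PP.uncov (T : Set PP.Point)).toFinset, ?_, ?_⟩
    · rw [saturating_iff_uncov_eq_empty, Set.eq_empty_iff_forall_notMem]
      intro Q hQ
      have hQ' : Q ∈ PP.uncov (T : Set PP.Point) := uncov_anti (by simp) hQ
      exact hQ.1 (by simp [hQ'])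
    · have := Finset.card_union_le T (PP.uncov (T : Set PP.Point)).toFinset
      omega

open scoped Classical in
variable (PP) in
theorem exists_pair_card_uncov_le :
    ∃ T : Finset PP.Point, T.card = 2 ∧ (PP.uncov ↑T).toFinset.card ≤ q ^ 2 := by
  obtain ⟨A, B, -, -, hAB, -⟩ := PP.nondeg
  refine ⟨{A, B}, Finset.card_pair hAB, ?_⟩
  obtain ⟨l, hA, hB⟩ := PP.exists_line_through A B hAB
  have hsub : (PP.uncov ↑({A, B} : Finset PP.Point)).toFinset ⊆
      (Finset.univ.filter fun P : PP.Point => P ∈ l)ᶜ := by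
    intro Q hQ
    rw [Set.mem_toFinset] at hQ
    simp only [Finset.mem_compl, Finset.mem_filter, Finset.mem_univ, true_and]
    intro hQl
    exact hAB (eq_of_mem_uncov hQ (by simp) (by simp) hA hB hQl)
  have := Finset.card_le_card hsub
  rw [Finset.card_compl, card_filter_mem_line, card_point] at this
  omega

open scoped Classical in
variable (PP) in
/-- The outcome of the greedy construction with `n + 2` points. -/
theorem exists_card_uncov_le_exp (hq : 0 < q) (n : ℕ) :
    ∃ T : Finset PP.Point, 1 < T.card ∧ T.card ≤ n + 2 ∧ ((PP.uncov ↑T).toFinset.card : ℝ) ≤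
      (q : ℝ) ^ 2 * Real.exp (-((n : ℝ) * (n + 3) / (2 * (q + 1)))) := by
  suffices ∃ T : Finset PP.Point, 1 < T.card ∧ T.card ≤ n + 2 ∧
      ((PP.uncov ↑T).Nonempty → T.card = n + 2) ∧ ((PP.uncov ↑T).toFinset.card : ℝ) ≤
      (q : ℝ) ^ 2 * Real.exp (-((n : ℝ) * (n + 3) / (2 * (q + 1)))) by
    obtain ⟨T, h₁, h₂, -, h₃⟩ := this
    exact ⟨T, h₁, h₂, h₃⟩
  induction n with
  | zero =>
    obtain ⟨T, hT, hR⟩ := PP.exists_pair_card_uncov_le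
    refine ⟨T, by omega, by omega, fun _ => by omega, ?_⟩
    simpa using (by exact_mod_cast hR : ((PP.uncov ↑T).toFinset.card : ℝ) ≤ (q : ℝ) ^ 2)
  | succ n ih =>
    obtain ⟨T, hT, hT', hcard, hR⟩ := ih
    rcases (PP.uncov (T : Set PP.Point)).eq_empty_or_nonempty with he | hne
    · refine ⟨T, hT, by omega, fun h => absurd he h.ne_empty, ?_⟩
      simp only [he, Set.toFinset_empty, Finset.card_empty, Nat.cast_zero]
      positivity
    · obtain ⟨P, hP, hle⟩ := exists_insert_card_uncov_le hq (Finset.card_pos.mp (by omega)) hne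
      have hTn := hcard hne
      have hc := Finset.card_insert_of_notMem hP
      refine ⟨insert P T, by omega, by omega, fun _ => by omega, ?_⟩
      rw [Finset.coe_insert]
      rw [hTn] at hle
      have hle' : ((q : ℝ) + 1) * (PP.uncov (insert P ↑T)).toFinset.card +
          ((n : ℝ) + 2) * (PP.uncov ↑T).toFinset.card ≤
          ((q : ℝ) + 1) * (PP.uncov ↑T).toFinset.card := by exact_mod_cast hle
      have hq1 : (0 : ℝ) < q + 1 := by positivity
      calc ((PP.uncov (insert P ↑T)).toFinset.card : ℝ)
          ≤ (PP.uncov ↑T).toFinset.card * (1 - (n + 2) / (q + 1)) := by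
            refine le_of_mul_le_mul_left ?_ hq1
            have : ((q : ℝ) + 1) * ((PP.uncov ↑T).toFinset.card * (1 - (n + 2) / (q + 1))) =
              ((q : ℝ) + 1) * (PP.uncov ↑T).toFinset.card -
                (n + 2) * (PP.uncov ↑T).toFinset.card := by field_simp
            rw [this]; linarith
        _ ≤ (PP.uncov ↑T).toFinset.card * Real.exp (-((n + 2) / (q + 1))) := by
            gcongr
            linarith [Real.add_one_le_exp (-(((n : ℝ) + 2) / (q + 1)))]
        _ ≤ (q : ℝ) ^ 2 * Real.exp (-((n : ℝ) * (n + 3) / (2 * (q + 1)))) *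
              Real.exp (-((n + 2) / (q + 1))) := by gcongr
        _ = _ := by
            rw [mul_assoc, ← Real.exp_add]
            congr 2
            push_cast
            field_simp
            ring

variable (PP) in
theorem exists_saturating_ncard_le (hq : 0 < q) (n : ℕ) {y : ℝ}
    (hy : (q : ℝ) ^ 2 * Real.exp (-((n : ℝ) * (n + 3) / (2 * (q + 1)))) ≤ y) :
    ∃ S : Set PP.Point, PP.Saturating S ∧ (S.ncard : ℝ) ≤ n + 2 + (y + 1) / 2 := by
  classical
  obtain ⟨T, hT, hTn, hR⟩ := PP.exists_card_uncov_le_exp hq n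
  obtain ⟨S, hS, hcard⟩ := exists_saturating_card_le T hT
  refine ⟨S, hS, ?_⟩
  rw [Set.ncard_coe_finset]
  have h : 2 * S.card ≤ 2 * (n + 2) + ((PP.uncov (T : Set PP.Point)).toFinset.card + 1) := by omega
  have h' : 2 * (S.card : ℝ) ≤
      2 * (n + 2) + (((PP.uncov (T : Set PP.Point)).toFinset.card : ℝ) + 1) := by exact_mod_cast h
  linarith

end ProjPlane

theorem saturating_set_bound_xi (q : ℕ) (hq : 2 ≤ q) (PP : ProjPlane q)
    (ξ : ℝ) (hξ : 1 ≤ ξ) :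
    ∃ S : Set PP.Point, PP.Saturating S ∧
      (S.ncard : ℝ) ≤ Real.sqrt (2 * (q + 1)) * Real.sqrt (Real.log ((q : ℝ) ^ 2 / ξ))
        + ξ / 2 + 3 := by
  have hq0 : 0 < q := by omega
  have hqR : (2 : ℝ) ≤ q := by exact_mod_cast hq
  have hξ0 : 0 < ξ := by linarith
  set X := Real.sqrt (2 * (q + 1)) * Real.sqrt (Real.log ((q : ℝ) ^ 2 / ξ)) with hX
  have hX0 : 0 ≤ X := by positivity
  rcases le_or_gt ((q : ℝ) ^ 2) ξ with hle | hlt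
  · obtain ⟨S, hS, hc⟩ := PP.exists_saturating_ncard_le hq0 0 (y := ξ) (by simpa using hle)
    refine ⟨S, hS, ?_⟩
    push_cast at hc
    linarith
  have hlog : 0 ≤ Real.log ((q : ℝ) ^ 2 / ξ) :=
    Real.log_nonneg ((one_le_div hξ0).mpr hlt.le)
  have hXsq : X ^ 2 = 2 * (q + 1) * Real.log ((q : ℝ) ^ 2 / ξ) := by
    rw [hX, mul_pow, Real.sq_sqrt (by positivity), Real.sq_sqrt hlog]
  have hξX : ξ = (q : ℝ) ^ 2 * Real.exp (-(X ^ 2 / (2 * (q + 1)))) := by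
    rw [hXsq, mul_div_cancel_left₀ _ (by positivity), Real.exp_neg, Real.exp_log (by positivity)]
    field_simp
  have hbound (n : ℕ) (hn : X ^ 2 ≤ n * (n + 3)) :
      (q : ℝ) ^ 2 * Real.exp (-((n : ℝ) * (n + 3) / (2 * (q + 1)))) ≤ ξ := by
    rw [hξX]
    gcongr
  rcases lt_or_ge X (1 / 2) with h | h
  · have hy : (q : ℝ) ^ 2 * Real.exp (-(((1 : ℕ) : ℝ) * ((1 : ℕ) + 3) / (2 * (q + 1)))) ≤ ξ - 1 := by
      have h₁ : Real.exp (-(((1 : ℕ) : ℝ) * ((1 : ℕ) + 3) / (2 * (q + 1)))) ≤ (q + 1) / (q + 3) := by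
        rw [Real.exp_neg, inv_le_comm₀ (Real.exp_pos _) (by positivity)]
        refine le_trans (le_of_eq ?_) (Real.add_one_le_exp _)
        push_cast
        field_simp
        ring
      have h₂ : 1 - 1 / (8 * ((q : ℝ) + 1)) ≤ Real.exp (-(X ^ 2 / (2 * (q + 1)))) := by
        refine le_trans ?_ (Real.add_one_le_exp _)
        have : X ^ 2 / (2 * ((q : ℝ) + 1)) ≤ (1 / 4) / (2 * (q + 1)) := by
          gcongr
          nlinarith
        have h' : (1 / 4) / (2 * ((q : ℝ) + 1)) = 1 / (8 * (q + 1)) := by field_simp; norm_num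
        linarith
      have h₃ : (q : ℝ) ^ 2 * ((q + 1) / (q + 3)) ≤ (q : ℝ) ^ 2 * (1 - 1 / (8 * ((q : ℝ) + 1))) - 1 := by
        rw [← sub_nonneg]
        have : (q : ℝ) ^ 2 * (1 - 1 / (8 * ((q : ℝ) + 1))) - 1 - (q : ℝ) ^ 2 * ((q + 1) / (q + 3)) =
          (q ^ 2 * (15 * q + 13) - 8 * (q + 1) * (q + 3)) / (8 * (q + 1) * (q + 3)) := by
          field_simp
          ring
        rw [this]
        apply div_nonneg _ (by positivity)
        nlinarith [mul_nonneg (sub_nonneg.mpr hqR) (sub_nonneg.mpr hqR),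
          mul_nonneg (sq_nonneg (q : ℝ)) (sub_nonneg.mpr hqR)]
      have h₄ := mul_le_mul_of_nonneg_left h₁ (sq_nonneg (q : ℝ))
      have h₅ := mul_le_mul_of_nonneg_left h₂ (sq_nonneg (q : ℝ))
      rw [← hξX] at h₅
      linarith
    obtain ⟨S, hS, hc⟩ := PP.exists_saturating_ncard_le hq0 1 hy
    refine ⟨S, hS, ?_⟩
    push_cast at hc
    linarith
  rcases lt_or_ge X 2 with h' | h'
  · obtain ⟨S, hS, hc⟩ := PP.exists_saturating_ncard_le hq0 1 (hbound 1 (by push_cast; nlinarith))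
    refine ⟨S, hS, ?_⟩
    push_cast at hc
    linarith
  · obtain ⟨n, hn⟩ : ∃ n, ⌈X⌉₊ = n + 1 :=
      Nat.exists_eq_succ_of_ne_zero (Nat.ceil_pos.mpr (by linarith)).ne'
    have h₁ := Nat.le_ceil X
    have h₂ := Nat.ceil_lt_add_one hX0
    rw [hn] at h₁ h₂
    push_cast at h₁ h₂
    obtain ⟨S, hS, hc⟩ := PP.exists_saturating_ncard_le hq0 n (hbound n (by nlinarith))
    exact ⟨S, hS, by linarith⟩
end

section
/- For every real number q ≥ 919 one has Δ(q) > 0, where Δ(q) = √(3q·ln q) + (1/2)√q + 2 − (√((q+1)(3·ln q + ln(ln q) + ln(3/4))) + √(q/(3·ln q)) + 3). -/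
/-- The difference between Nagy's bound and the bound of Theorem 1. -/
noncomputable def Delta (q : ℝ) : ℝ :=
  Real.sqrt (3 * q * Real.log q) + (1 / 2) * Real.sqrt q + 2 -
    (Real.sqrt ((q + 1) * (3 * Real.log q + Real.log (Real.log q) + Real.log (3 / 4)))
      + Real.sqrt (q / (3 * Real.log q)) + 3)

theorem Delta_pos (q : ℝ) (hq : 919 ≤ q) : 0 < Delta q := by
  have hq0 : 0 < q := by linarith
  have hlog2 := Real.log_two_gt_d9
  have hlog2' := Real.log_two_lt_d9
  have hL_lower : 6.23 ≤ Real.log q := by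
    have h : Real.log ((2 : ℝ) ^ 9) ≤ Real.log q :=
      Real.log_le_log (by norm_num) (by linarith)
    rw [Real.log_pow] at h
    push_cast at h
    linarith
  have hL_upper : 3 * Real.log q ≤ 0.0224 * q := by
    have h := Real.log_le_sub_one_of_pos (show 0 < q / 2 ^ 10 by positivity)
    rw [Real.log_div hq0.ne' (by norm_num), Real.log_pow] at h
    push_cast at h
    linarith
  set L := Real.log q
  have hL : 0 < L := by linarith
  set s := √q
  set y := √(3 * L)
  have hs2 : s ^ 2 = q := Real.sq_sqrt hq0.le
  have hy2 : y ^ 2 = 3 * L := Real.sq_sqrt (by positivity)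
  have hs : 30.3 ≤ s := Real.le_sqrt_of_sq_le (by linarith)
  have hy : 4.3 ≤ y := Real.le_sqrt_of_sq_le (by linarith)
  have hy0 : 0 < y := by linarith
  -- The tangent line of the logarithm at `y = 4` bounds the iterated logarithm.
  have hc : Real.log L + Real.log (3 / 4) ≤ y / 2 - 0.613 := by
    have h := Real.log_le_sub_one_of_pos (show 0 < y / 4 by positivity)
    have e : Real.log L + Real.log (3 / 4) = 2 * (Real.log (y / 4) + Real.log 2) := by
      rw [← Real.log_mul hL.ne' (by norm_num), ← Real.log_mul (by positivity) (by norm_num)]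
      rw [show L * (3 / 4) = (y / 4 * 2) ^ 2 by linear_combination (-1 / 4) * hy2, Real.log_pow]
      push_cast
      ring
    linarith
  have h_left : √(3 * q * L) = s * y := by
    rw [show 3 * q * L = q * (3 * L) by ring, Real.sqrt_mul hq0.le]
  have h_right : √(q / (3 * L)) = s * y⁻¹ := by
    rw [Real.sqrt_div hq0.le, div_eq_mul_inv]
  have hyi : y * y⁻¹ = 1 := mul_inv_cancel₀ hy0.ne'
  have hyi1 : y⁻¹ ≤ 1 := inv_le_one_of_one_le₀ (by linarith)
  have h_middle : √((q + 1) * (3 * L + Real.log L + Real.log (3 / 4)))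
      < s * (y + 0.466 - y⁻¹) := by
    rw [Real.sqrt_lt' (mul_pos (by linarith) (by linarith)), mul_pow, hs2]
    have hb : y ^ 2 + 0.932 * y - 2 ≤ (y + 0.466 - y⁻¹) ^ 2 := by
      nlinarith [sq_nonneg (0.466 - y⁻¹)]
    calc (q + 1) * (3 * L + Real.log L + Real.log (3 / 4))
        ≤ (q + 1) * (y ^ 2 + (y / 2 - 0.613)) :=
          mul_le_mul_of_nonneg_left (by linarith) (by linarith)
      _ < q * (y ^ 2 + 0.932 * y - 2) := by
        nlinarith [mul_le_mul hq hy (by norm_num) hq0.le]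
      _ ≤ q * (y + 0.466 - y⁻¹) ^ 2 := by gcongr
  have h_Delta : Delta q = s * y + 1 / 2 * s + 2 -
      (√((q + 1) * (3 * L + Real.log L + Real.log (3 / 4))) + s * y⁻¹ + 3) := by
    rw [← h_left, ← h_right]
    rfl
  rw [h_Delta]
  linarith
end

section
/- Let q ≥ 79 be a prime power and let N be an even integer of the form N = 2t − 2 where t ∈ {3, 4, 6} or t ≥ 8 (so N ∈ {4, 6, 10} or N ≥ 14 even). Then the projective space PG(N, q) contains a saturating set S with |S| ≤ Υ(q)·q^{(N−2)/2} + 2q^{(N−4)/2}, where Υ(q) = √((q+1)(3·ln q + ln(ln q) + ln(3/4))) + √(q/(3·ln q)) + 3. -/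
/-- A point set `S` in the projective space `ℙ F V` is saturating if every point
not in `S` lies on the line through two distinct points of `S`, i.e. its
representative vector lies in the span of the representatives of two distinct
points of `S`. -/
def SaturatingPG {F V : Type*} [Field F] [AddCommGroup V] [Module F V]
    (S : Set (Projectivization F V)) : Prop :=
  ∀ x : Projectivization F V, x ∉ S → ∃ a ∈ S, ∃ b ∈ S, a ≠ b ∧
    x.rep ∈ Submodule.span F {Projectivization.rep a, Projectivization.rep b}

/-- The bound `Υ(q)` of Theorem 1. -/
noncomputable def Upsilon (q : ℕ) : ℝ :=
  Real.sqrt ((q + 1) * (3 * Real.log q + Real.log (Real.log q) + Real.log (3 / 4)))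
    + Real.sqrt (q / (3 * Real.log q)) + 3

namespace Configuration

open Finset

section Uncovered

variable {P : Type*} (L : Type*) [Membership P L] [Fintype P]

open Classical in
/-- The points of a finite incidence structure which lie on no line joining two distinct points
of `K`. -/
noncomputable def uncovered (K : Finset P) : Finset P :=
  {x | ¬ ∃ a ∈ K, ∃ b ∈ K, a ≠ b ∧ ∃ l : L, a ∈ l ∧ b ∈ l ∧ x ∈ l}

variable {L}

theorem mem_uncovered {K : Finset P} {x : P} :
    x ∈ uncovered L K ↔ ¬ ∃ a ∈ K, ∃ b ∈ K, a ≠ b ∧ ∃ l : L, a ∈ l ∧ b ∈ l ∧ x ∈ l := by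
  simp [uncovered]

theorem notMem_uncovered {K : Finset P} {x a b : P} (ha : a ∈ K) (hb : b ∈ K) (hab : a ≠ b) {l : L}
    (hal : a ∈ l) (hbl : b ∈ l) (hxl : x ∈ l) : x ∉ uncovered L K := fun h ↦
  mem_uncovered.1 h ⟨a, ha, b, hb, hab, l, hal, hbl, hxl⟩

theorem uncovered_anti {K K' : Finset P} (h : K ⊆ K') : uncovered L K' ⊆ uncovered L K := by
  intro x hx
  rw [mem_uncovered] at hx ⊢
  rintro ⟨a, ha, b, hb, hab⟩
  exact hx ⟨a, h ha, b, h hb, hab⟩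

theorem notMem_of_mem_uncovered [HasLines P L] {K : Finset P} (hK : 2 ≤ #K) {x : P}
    (hx : x ∈ uncovered L K) : x ∉ K := by
  intro hxK
  obtain ⟨b, hb, hbx⟩ := exists_mem_ne (by lia : 1 < #K) x
  have hl := HasLines.mkLine_ax (L := L) hbx
  exact notMem_uncovered hb hxK hbx hl.1 hl.2 hl.2 hx

end Uncovered

section Plane

variable {P L : Type*} [Membership P L] [ProjectivePlane P L] [Fintype P]

open Classical in
theorem card_filter_mem_line [Finite L] (l : L) :
    #{p : P | p ∈ l} = ProjectivePlane.order P L + 1 := by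
  rw [← ProjectivePlane.pointCount_eq P l, pointCount, Nat.card_eq_fintype_card,
    Fintype.card_subtype]

open Classical in
/-- The number of points whose addition to `K` covers a given uncovered point. -/
theorem card_mul_le_card_covering [Finite L] {K : Finset P} (hK : 2 ≤ #K) {x : P}
    (hx : x ∈ uncovered L K) :
    #K * (ProjectivePlane.order P L - 1) ≤ #{p ∈ Kᶜ | x ∉ uncovered L (insert p K)} := by
  have hxK := notMem_of_mem_uncovered hK hx
  have hline : ∀ a, ∃ l : L, a ∈ K → x ∈ l ∧ a ∈ l := by
    intro a
    by_cases ha : a ∈ K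
    · have hne : x ≠ a := fun h ↦ hxK (h ▸ ha)
      exact ⟨HasLines.mkLine hne, fun _ ↦ HasLines.mkLine_ax hne⟩
    · obtain ⟨l, -⟩ := Nondegenerate.exists_line (L := L) a
      exact ⟨l, fun h ↦ absurd h ha⟩
  choose l hl using hline
  let B : P → Finset P := fun a ↦ ({p : P | p ∈ l a} : Finset P) \ {x, a}
  have hB : ∀ a ∈ K, ProjectivePlane.order P L - 1 ≤ #(B a) := by
    intro a _
    have h1 := le_card_sdiff {x, a} ({p : P | p ∈ l a} : Finset P)
    have h2 := card_le_two (a := x) (b := a)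
    rw [card_filter_mem_line] at h1
    change _ ≤ #(_ \ _)
    lia
  have hdisj : (K : Set P).PairwiseDisjoint B := by
    intro a ha b hb hab
    rw [Function.onFun, Finset.disjoint_left]
    intro p hpa hpb
    simp only [B, mem_sdiff, mem_filter, mem_univ, true_and, mem_insert, mem_singleton,
      not_or] at hpa hpb
    rcases Nondegenerate.eq_or_eq hpa.1 (hl a ha).1 hpb.1 (hl b hb).1 with h | h
    · exact hpa.2.1 h
    · exact notMem_uncovered ha hb hab (hl a ha).2 (h ▸ (hl b hb).2) (hl a ha).1 hx
  calc #K * (ProjectivePlane.order P L - 1) ≤ ∑ a ∈ K, #(B a) := by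
        simpa using card_nsmul_le_sum K _ _ hB
    _ = #(K.biUnion B) := (card_biUnion hdisj).symm
    _ ≤ _ := by
      refine card_le_card fun p hp ↦ ?_
      simp only [B, mem_biUnion, mem_sdiff, mem_filter, mem_univ, true_and, mem_insert,
        mem_singleton, not_or] at hp
      obtain ⟨a, ha, hpl, -, hpa⟩ := hp
      rw [mem_filter, mem_compl]
      exact ⟨fun hpK ↦ notMem_uncovered hpK ha hpa hpl (hl a ha).2 (hl a ha).1 hx,
        notMem_uncovered (mem_insert_self _ _) (mem_insert_of_mem ha) hpa hpl (hl a ha).2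
          (hl a ha).1⟩

open Classical in
/-- Averaging step: some new point covers at least the average number of uncovered points. -/
theorem exists_insert_card_uncovered_le [Finite L] {K : Finset P} (hK : 2 ≤ #K)
    (hK' : #K < Fintype.card P) :
    ∃ p ∉ K, #(uncovered L (insert p K)) * Fintype.card P +
      #(uncovered L K) * (#K * (ProjectivePlane.order P L - 1)) ≤
        #(uncovered L K) * Fintype.card P := by
  set U := uncovered L K
  let r : P → P → Prop := fun p x ↦ x ∉ uncovered L (insert p K)
  have hne : Kᶜ.Nonempty := by
    rw [← card_pos, card_compl]
    lia
  have hcount : #U * (#K * (ProjectivePlane.order P L - 1)) ≤ ∑ p ∈ Kᶜ, #{x ∈ U | r p x} := by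
    have h := sum_card_bipartiteAbove_eq_sum_card_bipartiteBelow r (s := Kᶜ) (t := U)
    simp only [bipartiteAbove, bipartiteBelow] at h
    rw [h]
    simpa using card_nsmul_le_sum U _ _ fun x hx ↦ card_mul_le_card_covering hK hx
  obtain ⟨p, hp, hmax⟩ := exists_max_image Kᶜ (fun p ↦ #{x ∈ U | r p x}) hne
  refine ⟨p, mem_compl.1 hp, ?_⟩
  have hsum : ∑ p ∈ Kᶜ, #{x ∈ U | r p x} ≤ Fintype.card P * #{x ∈ U | r p x} := by
    calc _ ≤ #Kᶜ * #{x ∈ U | r p x} := by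
          simpa using sum_le_card_nsmul Kᶜ _ _ hmax
      _ ≤ _ := Nat.mul_le_mul_right _ (card_le_univ _)
  have hsplit : #(uncovered L (insert p K)) + #{x ∈ U | r p x} = #U := by
    rw [← card_filter_add_card_filter_not (s := U) (r p), add_comm]
    congr 2
    ext x
    simp only [r, mem_filter, not_not]
    exact ⟨fun h ↦ ⟨uncovered_anti (subset_insert p K) h, h⟩, fun h ↦ h.2⟩
  calc _ ≤ #(uncovered L (insert p K)) * Fintype.card P +
        Fintype.card P * #{x ∈ U | r p x} :=
          Nat.add_le_add_left (hcount.trans hsum) _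
    _ = _ := by rw [← hsplit]; ring

/-- Greedy choice of `k` points of a projective plane leaving few points uncovered. -/
theorem exists_card_eq_card_uncovered_le [Finite L] {q : ℕ}
    (hq : ProjectivePlane.order P L = q) {k : ℕ}
    (hk : 2 ≤ k) (hkP : k ≤ q ^ 2 + q + 1) :
    ∃ K : Finset P, #K = k ∧ (#(uncovered L K) : ℝ) ≤
      q ^ 2 * Real.exp (-((q - 1) / (q ^ 2 + q + 1) * (k * (k - 1) / 2 - 1))) := by
  classical
  have hcard : Fintype.card P = q ^ 2 + q + 1 := by rw [ProjectivePlane.card_points P L, hq]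
  have hq1 : 1 < q := hq ▸ ProjectivePlane.one_lt_order P L
  have hM : (0 : ℝ) < q ^ 2 + q + 1 := by positivity
  induction k, hk using Nat.le_induction with
  | base =>
    obtain ⟨a, b, hab⟩ := Fintype.exists_pair_of_one_lt_card (α := P) (by rw [hcard]; lia)
    refine ⟨{a, b}, card_pair hab, ?_⟩
    have hl := HasLines.mkLine_ax (L := L) hab
    have hsub : uncovered L {a, b} ⊆ ({p : P | p ∈ HasLines.mkLine (L := L) hab} : Finset P)ᶜ := by
      intro x hx
      simp only [mem_compl, mem_filter, mem_univ, true_and]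
      intro hxl
      exact notMem_uncovered (by simp) (by simp) hab hl.1 hl.2 hxl hx
    have h := card_le_card hsub
    rw [card_compl, card_filter_mem_line, hcard, hq] at h
    have h' : #(uncovered L {a, b}) ≤ q ^ 2 := by lia
    have : (#(uncovered L {a, b}) : ℝ) ≤ (q : ℝ) ^ 2 := by exact_mod_cast h'
    norm_num
    exact this
  | succ k hk ih =>
    obtain ⟨K, hKk, hU⟩ := ih (by lia)
    obtain ⟨p, hp, hle⟩ := exists_insert_card_uncovered_le (L := L) (K := K) (by lia) (by lia)
    refine ⟨insert p K, by rw [card_insert_of_notMem hp, hKk], ?_⟩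
    rw [hcard, hKk, hq] at hle
    have hle' : (#(uncovered L (insert p K)) : ℝ) * (q ^ 2 + q + 1) +
        #(uncovered L K) * (k * (q - 1)) ≤ #(uncovered L K) * (q ^ 2 + q + 1) := by
      have := (Nat.cast_le (α := ℝ)).2 hle
      push_cast [Nat.cast_sub hq1.le] at this
      exact this
    have hstep : (#(uncovered L (insert p K)) : ℝ) ≤
        #(uncovered L K) * (1 - (q - 1) / (q ^ 2 + q + 1) * k) := by
      rw [← mul_le_mul_iff_left₀ hM]
      have : (#(uncovered L K) : ℝ) * (1 - (q - 1) / (q ^ 2 + q + 1) * k) * (q ^ 2 + q + 1) =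
          #(uncovered L K) * (q ^ 2 + q + 1) - #(uncovered L K) * (k * (q - 1)) := by
        field_simp
      rw [this]
      linarith
    calc (#(uncovered L (insert p K)) : ℝ)
        ≤ #(uncovered L K) * Real.exp (-((q - 1) / (q ^ 2 + q + 1) * k)) :=
          hstep.trans (by gcongr; exact Real.one_sub_le_exp_neg _)
      _ ≤ (q ^ 2 * Real.exp (-((q - 1) / (q ^ 2 + q + 1) * (k * (k - 1) / 2 - 1)))) *
          Real.exp (-((q - 1) / (q ^ 2 + q + 1) * k)) := by gcongr
      _ = _ := by
        rw [mul_assoc, ← Real.exp_add]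
        congr 2
        push_cast
        ring

/-- Any two uncovered points become covered after adding a single suitable point. -/
theorem exists_covering_pair {K : Finset P} (hK : 2 ≤ #K) {x y : P}
    (hx : x ∈ uncovered L K) (hy : y ∈ uncovered L K) [DecidableEq P] :
    ∃ p, x ∉ uncovered L (insert p K) ∧ y ∉ uncovered L (insert p K) := by
  obtain ⟨a, ha, b, hb, hab⟩ := one_lt_card.1 (by lia : 1 < #K)
  have hxa : x ≠ a := fun h ↦ notMem_of_mem_uncovered hK hx (h ▸ ha)
  have hyb : y ≠ b := fun h ↦ notMem_of_mem_uncovered hK hy (h ▸ hb)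
  obtain ⟨hxl, hal⟩ := HasLines.mkLine_ax (L := L) hxa
  obtain ⟨hym, hbm⟩ := HasLines.mkLine_ax (L := L) hyb
  set l : L := HasLines.mkLine hxa
  set m : L := HasLines.mkLine hyb
  have hlm : l ≠ m := fun h ↦ notMem_uncovered ha hb hab hal (h ▸ hbm) hxl hx
  obtain ⟨hpl, hpm⟩ := HasPoints.mkPoint_ax (P := P) hlm
  set p : P := HasPoints.mkPoint hlm
  have hpa : p ≠ a := fun h ↦ notMem_uncovered ha hb hab (h ▸ hpm) hbm hym hy
  have hpb : p ≠ b := fun h ↦ notMem_uncovered ha hb hab hal (h ▸ hpl) hxl hx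
  exact ⟨p, notMem_uncovered (mem_insert_self _ _) (mem_insert_of_mem ha) hpa hpl hal hxl,
    notMem_uncovered (mem_insert_self _ _) (mem_insert_of_mem hb) hpb hpm hbm hym⟩

/-- Covering the remaining points two at a time. -/
theorem exists_uncovered_eq_empty {K : Finset P} (hK : 2 ≤ #K) :
    ∃ K' : Finset P, #K' ≤ #K + (#(uncovered L K) + 1) / 2 ∧ uncovered L K' = ∅ := by
  classical
  induction hn : #(uncovered L K) using Nat.strong_induction_on generalizing K with
  | _ n ih =>
    rcases Nat.eq_zero_or_pos n with rfl | hpos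
    · exact ⟨K, by lia, card_eq_zero.1 hn⟩
    obtain ⟨p, hp⟩ : ∃ p, (#(uncovered L (insert p K)) + 1) / 2 + 1 ≤ (n + 1) / 2 := by
      obtain ⟨x, hx⟩ := card_pos.1 (hn ▸ hpos)
      rcases Nat.lt_or_ge n 2 with h | h
      · obtain ⟨p, hpx, -⟩ := exists_covering_pair hK hx hx
        have := card_lt_card ((ssubset_iff_of_subset (uncovered_anti (subset_insert p K))).2
          ⟨x, hx, hpx⟩)
        exact ⟨p, by lia⟩
      · obtain ⟨y, hy, hyx⟩ := exists_mem_ne (by lia : 1 < #(uncovered L K)) x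
        obtain ⟨p, hpx, hpy⟩ := exists_covering_pair hK hx hy
        have hsub : uncovered L (insert p K) ⊆ uncovered L K \ {x, y} := by
          intro z hz
          simp only [mem_sdiff, mem_insert, mem_singleton, not_or]
          exact ⟨uncovered_anti (subset_insert p K) hz, fun h ↦ hpx (h ▸ hz),
            fun h ↦ hpy (h ▸ hz)⟩
        have h2 : ({x, y} : Finset P) ⊆ uncovered L K := by
          simp [insert_subset_iff, hx, hy]
        have := card_le_card hsub
        rw [card_sdiff_of_subset h2, card_pair hyx.symm] at this
        exact ⟨p, by lia⟩
    have hins : #(insert p K) ≤ #K + 1 := card_insert_le _ _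
    obtain ⟨K', hK', hempty⟩ := ih _ (by lia)
      (hK.trans (card_le_card (subset_insert p K))) rfl
    exact ⟨K', by lia, hempty⟩

end Plane

end Configuration
section PairSpanning

open Finset Module
open scoped LinearAlgebra.Projectivization

/-- Every vector of the space is a linear combination of two members of `T`. -/
def IsPairSpanning (F : Type*) {V : Type*} [Field F] [AddCommGroup V] [Module F V]
    (T : Finset V) : Prop :=
  ∀ v : V, ∃ a ∈ T, ∃ b ∈ T, ∃ α β : F, v = α • a + β • b

variable {F V W : Type*} [Field F] [AddCommGroup V] [Module F V] [AddCommGroup W] [Module F W]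

theorem IsPairSpanning.image [DecidableEq W] {T : Finset V} (hT : IsPairSpanning F T)
    (f : V ≃ₗ[F] W) : IsPairSpanning F (T.image f) := by
  intro w
  obtain ⟨a, ha, b, hb, α, β, h⟩ := hT (f.symm w)
  refine ⟨f a, mem_image_of_mem f ha, f b, mem_image_of_mem f hb, α, β, ?_⟩
  rw [← f.map_smul, ← f.map_smul, ← f.map_add, ← h, f.apply_symm_apply]

/-- The projective points of a pair-spanning set of vectors form a saturating set. -/
theorem IsPairSpanning.exists_saturatingPG {T : Finset V} (hT : IsPairSpanning F T) :
    ∃ S : Set (ℙ F V), SaturatingPG S ∧ S.ncard ≤ #T := by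
  classical
  let S : Set (ℙ F V) := {x | ∃ a ∈ T, ∃ h : a ≠ 0, x = Projectivization.mk F a h}
  have hmem : ∀ x : ℙ F V, ∀ a ∈ T, ∀ c : F, x.rep = c • a → x ∈ S := by
    intro x a ha c hx
    have hca : c • a ≠ 0 := hx ▸ x.rep_nonzero
    have ha0 : a ≠ 0 := right_ne_zero_of_smul hca
    refine ⟨a, ha, ha0, ?_⟩
    rw [← x.mk_rep, Projectivization.mk_eq_mk_iff']
    exact ⟨c, hx.symm⟩
  refine ⟨S, ?_, ?_⟩
  · intro x hx
    obtain ⟨a, ha, b, hb, α, β, h⟩ := hT x.rep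
    have ha0 : a ≠ 0 := by
      rintro rfl
      exact hx (hmem x b hb β (by rw [h]; simp))
    have hb0 : b ≠ 0 := by
      rintro rfl
      exact hx (hmem x a ha α (by rw [h]; simp))
    refine ⟨_, ⟨a, ha, ha0, rfl⟩, _, ⟨b, hb, hb0, rfl⟩, ?_, ?_⟩
    · intro hab
      rw [Projectivization.mk_eq_mk_iff'] at hab
      obtain ⟨c, rfl⟩ := hab
      exact hx (hmem x b hb (α * c + β) (by rw [h, smul_smul, add_smul]))
    · obtain ⟨c, hc⟩ := Projectivization.exists_smul_eq_mk_rep F a ha0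
      obtain ⟨d, hd⟩ := Projectivization.exists_smul_eq_mk_rep F b hb0
      rw [Submodule.mem_span_pair, ← hc, ← hd]
      refine ⟨α * (c⁻¹ : Fˣ), β * (d⁻¹ : Fˣ), ?_⟩
      rw [h, mul_smul, mul_smul, ← Units.smul_def, ← Units.smul_def, inv_smul_smul, inv_smul_smul]
  · have hex : ∀ x : ℙ F V, ∃ a : V, x ∈ S →
        a ∈ T ∧ ∃ h : a ≠ 0, x = Projectivization.mk F a h := by
      intro x
      by_cases hx : x ∈ S
      · obtain ⟨a, ha⟩ := hx
        exact ⟨a, fun _ ↦ ha⟩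
      · exact ⟨0, fun h ↦ absurd h hx⟩
    choose g hg using hex
    rw [← Set.ncard_coe_finset]
    refine Set.ncard_le_ncard_of_injOn g (fun x hx ↦ (hg x hx).1) ?_ T.finite_toSet
    intro x hx y hy hxy
    obtain ⟨-, h, hx'⟩ := hg x hx
    obtain ⟨-, h', hy'⟩ := hg y hy
    rw [hx', hy']
    simp only [hxy]

/-- Vectors of `V` indexed with distinct nonzero elements of an extension field `E` lift to
a pair-spanning set of `V × E × E`. -/
theorem IsPairSpanning.exists_lift {E : Type*} [Field E] [Algebra F E] [Finite E]
    {T : Finset V} (hT : IsPairSpanning F T) (hcard : #T < Nat.card E) :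
    ∃ T' : Finset (V × E × E), IsPairSpanning F T' ∧
      #T' ≤ #T * Nat.card E + 2 * Nat.card (ℙ F E) := by
  classical
  have := Fintype.ofFinite E
  have : Finite (ℙ F E) := Quotient.finite _
  have := Fintype.ofFinite (ℙ F E)
  obtain ⟨f⟩ : Nonempty (T ↪ Eˣ) := by
    apply Function.Embedding.nonempty_of_card_le
    rw [Fintype.card_coe, Fintype.card_units, ← Nat.card_eq_fintype_card]
    lia
  let A : Finset (V × E × E) :=
    (T.attach ×ˢ (univ : Finset E)).image fun z ↦ (z.1.1, z.2, (f z.1 : E) * z.2)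
  let B : Finset (V × E × E) := (univ : Finset (ℙ F E)).image fun p ↦ (0, p.rep, 0)
  let C : Finset (V × E × E) := (univ : Finset (ℙ F E)).image fun p ↦ (0, 0, p.rep)
  have hA : ∀ (a : T) (ξ : E), ((a : V), ξ, (f a : E) * ξ) ∈ A ∪ (B ∪ C) := fun a ξ ↦
    mem_union_left _ (mem_image.2 ⟨(a, ξ), by simp, rfl⟩)
  have hrep : ∀ u : E, ∃ p : ℙ F E, ∃ c : F, u = c • p.rep := by
    intro u
    by_cases hu : u = 0
    · exact ⟨Projectivization.mk F 1 one_ne_zero, 0, by simp [hu]⟩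
    · obtain ⟨c, hc⟩ := Projectivization.exists_smul_eq_mk_rep F u hu
      refine ⟨Projectivization.mk F u hu, (c⁻¹ : Fˣ), ?_⟩
      rw [← hc, ← Units.smul_def, inv_smul_smul]
  have hB : ∀ p : ℙ F E, ((0 : V), p.rep, (0 : E)) ∈ A ∪ (B ∪ C) := fun p ↦
    mem_union_right _ (mem_union_left _ (mem_image_of_mem _ (mem_univ p)))
  have hC : ∀ p : ℙ F E, ((0 : V), (0 : E), p.rep) ∈ A ∪ (B ∪ C) := fun p ↦
    mem_union_right _ (mem_union_right _ (mem_image_of_mem _ (mem_univ p)))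
  refine ⟨A ∪ (B ∪ C), ?_, ?_⟩
  · have hsingle : ∀ (a : T) (c : F) (u v : E), ∃ x ∈ A ∪ (B ∪ C), ∃ y ∈ A ∪ (B ∪ C), ∃ α β : F,
        (c • (a : V), u, v) = α • x + β • y := by
      intro a c u v
      by_cases hc : c = 0
      · obtain ⟨p, α, rfl⟩ := hrep u
        obtain ⟨r, β, rfl⟩ := hrep v
        exact ⟨_, hB p, _, hC r, α, β, by simp [hc]⟩
      · obtain ⟨p, d, hd⟩ := hrep (u - (f a : E)⁻¹ * v)
        refine ⟨_, hA a (c⁻¹ • ((f a : E)⁻¹ * v)), _, hB p, c, d, ?_⟩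
        rw [eq_comm]
        simp only [Prod.smul_mk, Prod.mk_add_mk, smul_zero, add_zero, ← hd, mul_smul_comm,
          smul_inv_smul₀ hc, mul_inv_cancel_left₀ (f a).ne_zero, add_sub_cancel]
    rintro ⟨x, u, v⟩
    obtain ⟨a, ha, b, hb, α, β, rfl⟩ := hT x
    by_cases hab : a = b
    · subst hab
      simpa only [add_smul] using hsingle ⟨a, ha⟩ (α + β) u v
    by_cases hα : α = 0
    · simpa [hα] using hsingle ⟨b, hb⟩ β u v
    by_cases hβ : β = 0
    · simpa [hβ] using hsingle ⟨a, ha⟩ α u v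
    have hne : (f ⟨a, ha⟩ : E) - f ⟨b, hb⟩ ≠ 0 := by
      rw [sub_ne_zero, Units.val_injective.ne_iff, f.injective.ne_iff]
      simpa using hab
    set e := (f ⟨a, ha⟩ : E) with he
    set g := (f ⟨b, hb⟩ : E) with hg
    refine ⟨_, hA ⟨a, ha⟩ (α⁻¹ • ((v - g * u) / (e - g))), _,
      hA ⟨b, hb⟩ (β⁻¹ • (u - (v - g * u) / (e - g))), α, β, ?_⟩
    simp only [Prod.smul_mk, Prod.mk_add_mk, mul_smul_comm, smul_inv_smul₀ hα,
      smul_inv_smul₀ hβ, add_sub_cancel, ← he, ← hg, Prod.mk.injEq, true_and]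
    field_simp
    ring
  · calc #(A ∪ (B ∪ C)) ≤ #A + (#B + #C) :=
          (card_union_le _ _).trans (Nat.add_le_add_left (card_union_le _ _) _)
      _ ≤ #T * Nat.card E + (Nat.card (ℙ F E) + Nat.card (ℙ F E)) := by
        gcongr
        · refine card_image_le.trans ?_
          simp [Nat.card_eq_fintype_card]
        · exact card_image_le.trans (by simp [Nat.card_eq_fintype_card])
        · exact card_image_le.trans (by simp [Nat.card_eq_fintype_card])
      _ = _ := by ring

/-- A finite field has a finite extension of every positive degree. -/
theorem exists_field_extension_finrank_eq (F : Type) [Field F] [Finite F] {m : ℕ} (hm : m ≠ 0) :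
    ∃ (E : Type) (_ : Field E) (_ : Algebra F E), Finite E ∧ finrank F E = m := by
  obtain ⟨p, hp⟩ := CharP.exists F
  have : Fact p.Prime := ⟨CharP.char_is_prime F p⟩
  have : NeZero m := ⟨hm⟩
  have : Finite (FiniteField.Extension F p m) := Module.finite_of_finite F
  exact ⟨FiniteField.Extension F p m, inferInstance, inferInstance, this,
    FiniteField.finrank_extension F p m⟩

open Configuration in
/-- A point set of the plane over `F` covering everything by its secants is pair-spanning. -/
theorem isPairSpanning_image_rep [DecidableEq F] [Fintype (ℙ F (Fin 3 → F))]
    {K : Finset (ℙ F (Fin 3 → F))} (hK : uncovered (ℙ F (Fin 3 → F)) K = ∅) :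
    IsPairSpanning F (K.image Projectivization.rep) := by
  have hcov : ∀ x, ∃ a ∈ K, ∃ b ∈ K, a ≠ b ∧ ∃ l : ℙ F (Fin 3 → F), a ∈ l ∧ b ∈ l ∧ x ∈ l := by
    intro x
    by_contra h
    have := mem_uncovered.2 h
    simp [hK] at this
  intro v
  by_cases hv : v = 0
  · obtain ⟨a, ha, -⟩ := hcov (Projectivization.mk F ![1, 0, 0] (by simp))
    exact ⟨_, mem_image_of_mem _ ha, _, mem_image_of_mem _ ha, 0, 0, by simp [hv]⟩
  obtain ⟨a, ha, b, hb, hab, l, hal, hbl, hvl⟩ := hcov (Projectivization.mk F v hv)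
  refine ⟨_, mem_image_of_mem _ ha, _, mem_image_of_mem _ hb, ?_⟩
  rw [ofField.mem_iff] at hal hbl hvl
  rw [← a.mk_rep, ← l.mk_rep, Projectivization.orthogonal_mk] at hal
  rw [← b.mk_rep, ← l.mk_rep, Projectivization.orthogonal_mk] at hbl
  rw [← l.mk_rep, Projectivization.orthogonal_mk] at hvl
  have hdet : Matrix.det (Matrix.of ![a.rep, b.rep, v]) = 0 := by
    rw [← Matrix.exists_mulVec_eq_zero_iff]
    refine ⟨l.rep, l.rep_nonzero, ?_⟩
    ext i
    fin_cases i
    · exact hal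
    · exact hbl
    · exact hvl
  rw [← Matrix.exists_vecMul_eq_zero_iff] at hdet
  obtain ⟨c, hc, h⟩ := hdet
  have hsum : c 0 • a.rep + c 1 • b.rep + c 2 • v = 0 := by
    rw [← h, Matrix.vecMul_eq_sum, Fin.sum_univ_three]
    rfl
  have hc2 : c 2 ≠ 0 := by
    intro h2
    rw [h2, zero_smul, add_zero] at hsum
    have hind := (Projectivization.independent_pair_iff_ne a b).2 hab
    rw [Projectivization.independent_iff] at hind
    have hcomp : Projectivization.rep ∘ ![a, b] = ![a.rep, b.rep] := by
      funext i
      fin_cases i <;> rfl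
    rw [hcomp] at hind
    have h01 := LinearIndependent.pair_iff.1 hind _ _ hsum
    apply hc
    ext i
    fin_cases i
    · exact h01.1
    · exact h01.2
    · exact h2
  refine ⟨-((c 2)⁻¹ * c 0), -((c 2)⁻¹ * c 1), ?_⟩
  have hv2 : c 2 • v = -(c 0 • a.rep + c 1 • b.rep) := by
    rw [eq_neg_iff_add_eq_zero, add_comm]
    exact hsum
  rw [← inv_smul_smul₀ hc2 v, hv2, smul_neg, smul_add, smul_smul, smul_smul, neg_smul, neg_smul,
    neg_add]

end PairSpanning
section Estimates

open Real

/-- The greedy part of the bound, `√((q + 1) (3 ln q + ln ln q + ln (3/4)))`, lies between `15`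
and `3q/5`. -/
theorem sqrt_log_sum_bounds {q : ℝ} (hq : 79 ≤ q) :
    15 ≤ √((q + 1) * (3 * log q + log (log q) + log (3 / 4))) ∧
      √((q + 1) * (3 * log q + log (log q) + log (3 / 4))) ≤ 3 / 5 * q := by
  have hexp4 : (50 : ℝ) ≤ exp 4 := by
    have h : exp 4 = exp 1 ^ 4 := by rw [← exp_nat_mul]; norm_num
    rw [h]
    calc (50 : ℝ) ≤ 2.7 ^ 4 := by norm_num
      _ ≤ exp 1 ^ 4 := by gcongr; linarith [exp_one_gt_d9]
  have hlog2 : 2 ≤ log q := by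
    rw [le_log_iff_exp_le (by linarith)]
    have h : exp 2 = exp 1 ^ 2 := by rw [← exp_nat_mul]; norm_num
    rw [h]
    calc exp 1 ^ 2 ≤ 3 ^ 2 := by gcongr; linarith [exp_one_lt_d9]
      _ ≤ q := by linarith
  have hlog : log q ≤ 3 + q / 50 := by
    have h := add_one_le_exp (log q - 4)
    rw [exp_sub, exp_log (by linarith)] at h
    have : q / exp 4 ≤ q / 50 := by gcongr
    linarith
  have hloglog : 0 ≤ log (log q) := log_nonneg (by linarith)
  have hloglog' : log (log q) ≤ log q - 1 := log_le_sub_one_of_pos (by linarith)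
  have h34 : log (3 / 4) ≤ 0 := log_nonpos (by norm_num) (by norm_num)
  have h34' : -1 ≤ log (3 / 4) := by
    have := one_sub_inv_le_log_of_pos (show (0 : ℝ) < 3 / 4 by norm_num)
    norm_num at this
    linarith
  constructor
  · apply le_sqrt_of_sq_le
    nlinarith
  · rw [sqrt_le_left (by linarith)]
    have : 3 * log q + log (log q) + log (3 / 4) ≤ 4 * (3 + q / 50) := by linarith
    calc (q + 1) * (3 * log q + log (log q) + log (3 / 4)) ≤ (q + 1) * (4 * (3 + q / 50)) := by
          gcongr
      _ ≤ (3 / 5 * q) ^ 2 := by nlinarith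

/-- After `√((q + 1) (3 ln q + ln ln q + ln (3/4))) + 7/5` greedy steps at most
`2 √(q / (3 ln q))` points are left. -/
theorem sq_mul_exp_neg_le {q k : ℝ} (hq : 79 ≤ q)
    (hk : √((q + 1) * (3 * log q + log (log q) + log (3 / 4))) + 7 / 5 ≤ k) :
    q ^ 2 * exp (-((q - 1) / (q ^ 2 + q + 1) * (k * (k - 1) / 2 - 1))) ≤
      2 * √(q / (3 * log q)) := by
  obtain ⟨h15, h35⟩ := sqrt_log_sum_bounds hq
  set Λ := 3 * log q + log (log q) + log (3 / 4) with hΛ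
  set r := √((q + 1) * Λ) with hr
  have hlog : 0 < log q := log_pos (by linarith)
  have hr2 : r ^ 2 = (q + 1) * Λ := by
    refine sq_sqrt ?_
    by_contra h
    rw [hr, sqrt_eq_zero_of_nonpos (not_le.1 h).le] at h15
    norm_num at h15
  have hexponent : Λ / 2 ≤ (q - 1) / (q ^ 2 + q + 1) * (k * (k - 1) / 2 - 1) := by
    have hkk : r ^ 2 + 17 / 10 * r ≤ k * (k - 1) - 2 := by nlinarith
    have hrq : (q + 2) * r ≤ 17 / 10 * (q ^ 2 - 1) := by nlinarith
    have hrΛ : (q + 2) * Λ ≤ (q - 1) * (17 / 10 * r) := by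
      have h : (q + 1) * ((q + 2) * Λ) ≤ (q + 1) * ((q - 1) * (17 / 10 * r)) := by
        calc (q + 1) * ((q + 2) * Λ) = ((q + 2) * r) * r := by linear_combination -(q + 2) * hr2
          _ ≤ (17 / 10 * (q ^ 2 - 1)) * r := by gcongr
          _ = _ := by ring
      exact le_of_mul_le_mul_left h (by linarith)
    have hmain : Λ * (q ^ 2 + q + 1) ≤ (q - 1) * (k * (k - 1) - 2) := by
      calc Λ * (q ^ 2 + q + 1) = (q - 1) * r ^ 2 + (q + 2) * Λ := by rw [hr2]; ring
        _ ≤ (q - 1) * (r ^ 2 + 17 / 10 * r) := by linarith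
        _ ≤ _ := mul_le_mul_of_nonneg_left hkk (by linarith)
    rw [div_mul_eq_mul_div, le_div_iff₀ (by positivity)]
    linarith
  have hexp : exp Λ = q ^ 3 * log q * (3 / 4) := by
    rw [hΛ, exp_add, exp_add, exp_log hlog, exp_log (by norm_num)]
    congr 2
    rw [show 3 * log q = log (q ^ 3) by rw [log_pow]; norm_num, exp_log (by positivity)]
  have hsq : (q ^ 2 * exp (-(Λ / 2))) ^ 2 = (2 * √(q / (3 * log q))) ^ 2 := by
    have h1 : exp (-(Λ / 2)) ^ 2 = (exp Λ)⁻¹ := by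
      rw [← exp_neg, ← exp_nat_mul]
      congr 1
      push_cast
      ring
    rw [mul_pow, mul_pow, h1, hexp, sq_sqrt (by positivity)]
    field_simp
    norm_num
  calc _ ≤ q ^ 2 * exp (-(Λ / 2)) := by gcongr
    _ ≤ _ := (pow_le_pow_iff_left₀ (by positivity) (by positivity) two_ne_zero).1 hsq.le

theorem sqrt_div_log_le {q : ℝ} (hq : 79 ≤ q) : √(q / (3 * log q)) ≤ q / 8 := by
  have hlog : 1 ≤ log q := by
    rw [le_log_iff_exp_le (by linarith)]
    linarith [exp_one_lt_d9]
  rw [sqrt_le_left (by linarith), div_le_iff₀ (by linarith)]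
  nlinarith

end Estimates

section Construction

open Finset Module
open scoped LinearAlgebra.Projectivization

theorem order_projectivization_fin_three (F : Type*) [Field F] [Fintype F] [DecidableEq F] :
    Configuration.ProjectivePlane.order (ℙ F (Fin 3 → F)) (ℙ F (Fin 3 → F)) = Fintype.card F := by
  have : Finite (ℙ F (Fin 3 → F)) := Quotient.finite _
  have := Fintype.ofFinite (ℙ F (Fin 3 → F))
  have h := Configuration.ProjectivePlane.card_points (ℙ F (Fin 3 → F)) (ℙ F (Fin 3 → F))
  rw [← Nat.card_eq_fintype_card, Projectivization.card_of_finrank F _ (finrank_fin_fun F),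
    Nat.card_eq_fintype_card] at h
  simp only [sum_range_succ, range_zero, sum_empty, pow_zero, pow_one, zero_add] at h
  nlinarith

/-- The plane case, with a small margin to spare. -/
theorem exists_isPairSpanning_plane {F : Type*} [Field F] [Fintype F] {q : ℕ}
    (hF : Fintype.card F = q) (hq : 79 ≤ q) :
    ∃ T : Finset (Fin 3 → F), IsPairSpanning F T ∧ #T < q ∧ (#T : ℝ) + 1 / 39 ≤ Upsilon q := by
  classical
  have : Finite (ℙ F (Fin 3 → F)) := Quotient.finite _
  have := Fintype.ofFinite (ℙ F (Fin 3 → F))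
  have hord := (order_projectivization_fin_three F).trans hF
  have hq' : (79 : ℝ) ≤ q := by exact_mod_cast hq
  obtain ⟨h15, h35⟩ := sqrt_log_sum_bounds hq'
  have hs := sqrt_div_log_le hq'
  have hΥ : Upsilon q = _ + _ + 3 := rfl
  have hexp := sq_mul_exp_neg_le hq' (Nat.le_ceil _)
  set r := √(((q : ℝ) + 1) * (3 * Real.log q + Real.log (Real.log q) + Real.log (3 / 4)))
  set s := √((q : ℝ) / (3 * Real.log q))
  set k := ⌈r + 7 / 5⌉₊
  have hk_lt : (k : ℝ) < r + 7 / 5 + 1 := Nat.ceil_lt_add_one (by linarith)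
  have hk2 : 2 ≤ k := by
    rw [← Nat.cast_le (α := ℝ)]
    push_cast
    linarith [Nat.le_ceil (r + 7 / 5)]
  have hkq : k ≤ q := by
    rw [← Nat.cast_le (α := ℝ)]
    linarith
  obtain ⟨K, hKk, hU⟩ := Configuration.exists_card_eq_card_uncovered_le hord hk2 (by nlinarith)
  obtain ⟨K', hK', hempty⟩ := Configuration.exists_uncovered_eq_empty
    (L := ℙ F (Fin 3 → F)) (K := K) (by lia)
  have hU2 := hU.trans hexp
  have hK'r : (#K' : ℝ) ≤ k + s + 1 / 2 := by
    have h1 : 2 * #K' ≤ 2 * k + #(Configuration.uncovered (ℙ F (Fin 3 → F)) K) + 1 := by lia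
    have h2 : (2 : ℝ) * #K' ≤ 2 * k + #(Configuration.uncovered (ℙ F (Fin 3 → F)) K) + 1 := by
      exact_mod_cast h1
    linarith
  have hTK : #(K'.image Projectivization.rep) ≤ #K' := card_image_le
  have hTK' : (#(K'.image Projectivization.rep) : ℝ) ≤ #K' := by exact_mod_cast hTK
  refine ⟨K'.image Projectivization.rep, isPairSpanning_image_rep hempty, ?_, ?_⟩
  · rw [← Nat.cast_lt (α := ℝ)]
    linarith
  · rw [hΥ]
    linarith

end Construction

theorem saturating_set_even_dim_bound (q : ℕ) (hq : IsPrimePow q) (hq79 : 79 ≤ q)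
    (F : Type) [Field F] [Fintype F] (hF : Fintype.card F = q)
    (t N : ℕ) (ht : t = 3 ∨ t = 4 ∨ t = 6 ∨ 8 ≤ t) (hN : N = 2 * t - 2) :
    ∃ S : Set (Projectivization F (Fin (N + 1) → F)), SaturatingPG S ∧
      (S.ncard : ℝ) ≤ Upsilon q * (q : ℝ) ^ ((N - 2) / 2) + 2 * (q : ℝ) ^ ((N - 4) / 2) := by
  classical
  obtain ⟨m, rfl⟩ : ∃ m, t = m + 2 := ⟨t - 2, by lia⟩
  have hm : m ≠ 0 := by lia
  rw [show (N - 2) / 2 = m by lia]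
  obtain ⟨T, hT, hTq, hTΥ⟩ := exists_isPairSpanning_plane hF hq79
  obtain ⟨E, _, _, _, hEm⟩ := exists_field_extension_finrank_eq F hm
  have hFq : Nat.card F = q := by rw [Nat.card_eq_fintype_card, hF]
  have hE : Nat.card E = q ^ m := by rw [Module.natCard_eq_pow_finrank (K := F), hFq, hEm]
  obtain ⟨T', hT', hcard⟩ := hT.exists_lift (E := E)
    (by rw [hE]; exact hTq.trans_le (Nat.le_self_pow hm q))
  have : Module.Finite F E := Module.finite_of_finrank_pos (by lia)
  let e : ((Fin 3 → F) × E × E) ≃ₗ[F] (Fin (N + 1) → F) := LinearEquiv.ofFinrankEq _ _ (by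
    simp only [Module.finrank_prod, Module.finrank_fin_fun, hEm]
    lia)
  obtain ⟨S, hS, hST⟩ := (hT'.image e).exists_saturatingPG
  refine ⟨S, hS, ?_⟩
  have hq' : (79 : ℝ) ≤ q := by exact_mod_cast hq79
  have hP : (Nat.card (Projectivization F E) : ℝ) * 78 ≤ q ^ m := by
    have h := Projectivization.card F E
    rw [hE, hFq] at h
    have h' : Nat.card (Projectivization F E) * 78 ≤ q ^ m :=
      (Nat.mul_le_mul_left _ (by lia)).trans (h ▸ Nat.sub_le _ _)
    exact_mod_cast h'
  have hSreal : (S.ncard : ℝ) ≤ T.card * q ^ m + 2 * Nat.card (Projectivization F E) := by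
    rw [hE] at hcard
    exact_mod_cast (hST.trans Finset.card_image_le).trans hcard
  have hpow : (0 : ℝ) ≤ 2 * (q : ℝ) ^ ((N - 4) / 2) := by positivity
  have hmul := mul_le_mul_of_nonneg_right hTΥ (by positivity : (0 : ℝ) ≤ (q : ℝ) ^ m)
  linarith
end

section
/- Let q ≥ 79 be a prime power and let N ∈ {8, 12}. Then the projective space PG(N, q) contains a saturating set S with |S| ≤ Υ(q)·q^{(N−2)/2} + 2q^{(N−4)/2} + q^{(N−6)/2} + q^{(N−8)/2}, where Υ(q) = √((q+1)(3·ln q + ln(ln q) + ln(3/4))) + √(q/(3·ln q)) + 3. -/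
open Finset

section Greedy

variable {F V : Type*} [Field F] [AddCommGroup V] [Module F V] [Fintype V]

open Classical in
/-- The nonzero vectors that are not in the span of two members of `T`. -/
noncomputable def uncovered (F : Type*) {V : Type*} [Field F] [AddCommGroup V] [Module F V]
    [Fintype V] (T : Finset V) : Finset V :=
  {v | v ≠ 0 ∧ ∀ a ∈ T, ∀ b ∈ T, v ∉ Submodule.span F {a, b}}

lemma mem_uncovered {T : Finset V} {v : V} :
    v ∈ uncovered F T ↔ v ≠ 0 ∧ ∀ a ∈ T, ∀ b ∈ T, v ∉ Submodule.span F {a, b} := by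
  simp [uncovered]

/-- The members of `T` represent pairwise distinct projective points. -/
def RepresentsDistinctPoints (F : Type*) {V : Type*} [Field F] [AddCommGroup V] [Module F V]
    (T : Finset V) : Prop :=
  0 ∉ T ∧ ∀ a ∈ T, ∀ b ∈ T, a ≠ b → LinearIndependent F ![a, b]

lemma smul_mem_uncovered {T : Finset V} {v : V} (hv : v ∈ uncovered F T) {c : F} (hc : c ≠ 0) :
    c • v ∈ uncovered F T := by
  rw [mem_uncovered] at hv ⊢
  refine ⟨smul_ne_zero hc hv.1, fun a ha b hb h => hv.2 a ha b hb ?_⟩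
  simpa [smul_smul, hc] using Submodule.smul_mem _ c⁻¹ h

/-- If `v` is uncovered by `T`, the vectors `c • v + d • a` with `a ∈ T` and `c, d ≠ 0` together
with the `c • v` are pairwise distinct. -/
lemma injective_line_points {T : Finset V} (hT : RepresentsDistinctPoints F T) {v : V}
    (hv : v ∈ uncovered F T) :
    Function.Injective (fun z : Fˣ × Option (T × Fˣ) =>
      (z.1 : F) • v + z.2.elim 0 (fun y => (y.2 : F) • (y.1 : V))) := by
  rw [mem_uncovered] at hv
  obtain ⟨hv0, hv⟩ := hv
  have key : ∀ c c' : F, ∀ a ∈ T, ∀ b ∈ T, ∀ d e : F,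
      c • v + d • a = c' • v + e • b → c = c' := by
    intro c c' a ha b hb d e h
    by_contra hne
    have hs : c - c' ≠ 0 := sub_ne_zero.2 hne
    refine hv a ha b hb (Submodule.mem_span_pair.2
      ⟨(c - c')⁻¹ * (-d), (c - c')⁻¹ * e, ?_⟩)
    rw [mul_smul, mul_smul, ← smul_add, inv_smul_eq_iff₀ hs]
    linear_combination (norm := module) (-1 : F) • h
  rintro ⟨c, o⟩ ⟨c', o'⟩ h
  rcases o with _ | ⟨⟨a, ha⟩, d⟩ <;> rcases o' with _ | ⟨⟨b, hb⟩, e⟩ <;>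
    simp only [Option.elim_none, Option.elim_some, add_zero] at h
  · have := smul_left_injective F hv0 h
    simp only [Units.ext this]
  · have hc := key c c' b hb b hb 0 e (by simpa using h)
    rw [hc, left_eq_add, smul_eq_zero] at h
    rcases h with h | h
    · exact absurd h e.ne_zero
    · exact absurd (h ▸ hb) hT.1
  · have hc := key c c' a ha a ha d 0 (by simpa using h)
    rw [hc, add_eq_left, smul_eq_zero] at h
    rcases h with h | h
    · exact absurd h d.ne_zero
    · exact absurd (h ▸ ha) hT.1
  · have hc := key c c' a ha b hb d e h
    rw [hc, add_right_inj] at h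
    have hab : a = b := by
      by_contra hab
      have := (LinearIndependent.pair_iff.1 (hT.2 a ha b hb hab)) d (-e) (by simp [h])
      exact d.ne_zero this.1
    subst hab
    have hde := smul_left_injective F (fun h0 => hT.1 (h0 ▸ ha)) h
    simp only [Units.ext hc, Units.ext hde]

/-- In a three-dimensional space one new vector covers two uncovered points. -/
lemma exists_vector_covering_two (hV : Module.finrank F V = 3) {T : Finset V} {a b : V}
    (ha : a ∈ T) (hb : b ∈ T) (hab : LinearIndependent F ![a, b]) {v w : V}
    (hv : v ∈ uncovered F T) (hw : w ∈ uncovered F T) :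
    ∃ p, v ∈ Submodule.span F {p, a} ∧ w ∈ Submodule.span F {p, b} := by
  rw [mem_uncovered] at hv hw
  have hdep : ¬ LinearIndependent F ![v, a, w, b] := by
    intro h
    have := h.fintype_card_le_finrank
    simp [hV] at this
  obtain ⟨g, hg, i, hi⟩ := Fintype.not_linearIndependent_iff.1 hdep
  simp only [Fin.sum_univ_four, Matrix.cons_val] at hg
  rw [LinearIndependent.pair_iff] at hab
  have hdegenerate : ∀ x ∈ uncovered F T, ∀ r s t : F, r • x + s • a + t • b = 0 →
      r = 0 ∧ s = 0 ∧ t = 0 := by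
    intro x hx r s t h
    have hr : r = 0 := by
      by_contra hr
      refine (mem_uncovered.1 hx).2 a ha b hb (Submodule.mem_span_pair.2
        ⟨r⁻¹ * (-s), r⁻¹ * (-t), ?_⟩)
      rw [mul_smul, mul_smul, ← smul_add, inv_smul_eq_iff₀ hr]
      linear_combination (norm := module) (-1 : F) • h
    subst hr
    exact ⟨rfl, hab s t (by simpa using h)⟩
  have h0 : g 0 ≠ 0 := by
    intro h0
    obtain ⟨h2, h1, h3⟩ := hdegenerate w (mem_uncovered.2 hw) (g 2) (g 1) (g 3)
      (by rw [h0, zero_smul] at hg; linear_combination (norm := module) (1 : F) • hg)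
    have hall : ∀ j, g j = 0 := by simp [Fin.forall_fin_succ, h0, h1, h2, h3]
    exact hi (hall i)
  have h2 : g 2 ≠ 0 := by
    intro h2
    have := hdegenerate v (mem_uncovered.2 hv) (g 0) (g 1) (g 3)
      (by rw [h2, zero_smul] at hg; linear_combination (norm := module) (1 : F) • hg)
    exact h0 this.1
  refine ⟨g 0 • v + g 1 • a, Submodule.mem_span_pair.2 ⟨(g 0)⁻¹, -((g 0)⁻¹ * g 1), ?_⟩,
    Submodule.mem_span_pair.2 ⟨-(g 2)⁻¹, -((g 2)⁻¹ * g 3), ?_⟩⟩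
  · simp [smul_smul, h0]
  · have : g 0 • v + g 1 • a = -(g 2 • w + g 3 • b) := by
      linear_combination (norm := module) (1 : F) • hg
    rw [this]
    simp [smul_smul, h2]

variable [Fintype F]

/-- Some vector covers at least the average number of uncovered vectors. -/
lemma exists_insert_uncovered_le {T : Finset V} (hT : RepresentsDistinctPoints F T)
    (hne : (uncovered F T).Nonempty) [DecidableEq V] :
    ∃ p, p ∉ T ∧ RepresentsDistinctPoints F (insert p T) ∧
      (uncovered F (insert p T)).card * Fintype.card V +
        (uncovered F T).card * ((Fintype.card F - 1) * (T.card * (Fintype.card F - 1) + 1)) ≤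
      (uncovered F T).card * Fintype.card V := by
  classical
  set c := (Fintype.card F - 1) * (T.card * (Fintype.card F - 1) + 1) with hc
  have hq : 1 < Fintype.card F := Fintype.one_lt_card
  have hcpos : 0 < c := Nat.mul_pos (by omega) (by omega)
  let R : V → V → Prop := fun p v => ∃ a ∈ insert p T, v ∈ Submodule.span F {p, a}
  have hcount : ∀ v ∈ uncovered F T, c ≤ (univ.filter (fun p => R p v)).card := by
    intro v hv
    have hcard : Fintype.card (Fˣ × Option (T × Fˣ)) = c := by
      simp [Fintype.card_units, hc]
    rw [← hcard, ← Finset.card_univ]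
    refine Finset.card_le_card_of_injOn _ ?_ (injective_line_points hT hv).injOn
    rintro ⟨s, o⟩ -
    simp only [coe_filter, mem_univ, true_and, Set.mem_ofPred_eq]
    rcases o with _ | ⟨⟨a, ha⟩, d⟩
    · exact ⟨_, mem_insert_self _ _, Submodule.mem_span_pair.2 ⟨(s : F)⁻¹, 0, by simp⟩⟩
    · refine ⟨a, mem_insert_of_mem ha,
        Submodule.mem_span_pair.2 ⟨(s : F)⁻¹, -((s : F)⁻¹ * d), ?_⟩⟩
      simp [smul_smul]
  have hdouble : ∑ p : V, ((uncovered F T).filter (fun v => R p v)).card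
      = ∑ v ∈ uncovered F T, (univ.filter (fun p => R p v)).card :=
    Finset.sum_card_bipartiteAbove_eq_sum_card_bipartiteBelow (s := univ) R
  have hsum : (uncovered F T).card * c ≤
      ∑ p : V, ((uncovered F T).filter (fun v => R p v)).card := by
    rw [hdouble, ← smul_eq_mul]
    exact Finset.card_nsmul_le_sum _ _ _ hcount
  obtain ⟨p, -, hp⟩ : ∃ p ∈ (univ : Finset V), (uncovered F T).card * c ≤
      ((uncovered F T).filter (fun v => R p v)).card * Fintype.card V := by
    by_contra! hcon
    have h1 := Finset.sum_lt_sum_of_nonempty univ_nonempty hcon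
    rw [← Finset.sum_mul, sum_const, smul_eq_mul, card_univ] at h1
    nlinarith
  have hpos : 0 < ((uncovered F T).filter (fun v => R p v)).card := by
    by_contra! h0
    have := Nat.mul_pos hne.card_pos hcpos
    rw [Nat.le_zero.1 h0] at hp
    omega
  obtain ⟨v, hv⟩ := Finset.card_pos.1 hpos
  rw [mem_filter, mem_uncovered] at hv
  obtain ⟨⟨hv0, hv⟩, w, hw, hvw⟩ := hv
  have hpspan : ∀ a ∈ T, p ∉ Submodule.span F {a} := by
    intro a ha hpa
    obtain ⟨s, rfl⟩ := Submodule.mem_span_singleton.1 hpa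
    obtain ⟨x, y, rfl⟩ := Submodule.mem_span_pair.1 hvw
    rcases mem_insert.1 hw with rfl | hw
    · exact hv a ha a ha (Submodule.mem_span_pair.2 ⟨x * s, y * s, by simp [mul_smul]⟩)
    · exact hv a ha w hw (Submodule.mem_span_pair.2 ⟨x * s, y, by simp [mul_smul]⟩)
  have hp0 : p ≠ 0 := by
    rintro rfl
    obtain ⟨x, y, rfl⟩ := Submodule.mem_span_pair.1 hvw
    rcases mem_insert.1 hw with rfl | hw
    · simp at hv0
    · exact hpspan w hw (Submodule.zero_mem _)
  have hpair : ∀ a ∈ T, LinearIndependent F ![a, p] := by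
    intro a ha
    rw [LinearIndependent.pair_iff' (fun h => hT.1 (h ▸ ha))]
    exact fun s hs => hpspan a ha (Submodule.mem_span_singleton.2 ⟨s, hs⟩)
  refine ⟨p, fun hpT => hpspan p hpT (Submodule.mem_span_singleton_self p), ⟨?_, ?_⟩, ?_⟩
  · rw [mem_insert, not_or]
    exact ⟨hp0.symm, hT.1⟩
  · intro a ha b hb hab
    rcases mem_insert.1 ha with rfl | haT <;> rcases mem_insert.1 hb with rfl | hbT
    · exact absurd rfl hab
    · exact LinearIndependent.pair_symm_iff.1 (hpair b hbT)
    · exact hpair a haT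
    · exact hT.2 a haT b hbT hab
  · have hsub : uncovered F (insert p T) ⊆ (uncovered F T).filter (fun v => ¬ R p v) := by
      intro u hu
      rw [mem_uncovered] at hu
      rw [mem_filter, mem_uncovered]
      refine ⟨⟨hu.1, fun a ha b hb => hu.2 a (mem_insert_of_mem ha) b (mem_insert_of_mem hb)⟩, ?_⟩
      rintro ⟨a, ha, hua⟩
      exact hu.2 p (mem_insert_self _ _) a ha hua
    have h1 := card_le_card hsub
    have h2 := card_filter_add_card_filter_not (s := uncovered F T) (fun v => R p v)
    calc _ ≤ ((uncovered F T).filter (fun v => ¬ R p v)).card * Fintype.card V +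
          ((uncovered F T).filter (fun v => R p v)).card * Fintype.card V := by gcongr
      _ = (uncovered F T).card * Fintype.card V := by rw [← h2]; ring

/-- In a three-dimensional space the uncovered points can be covered two at a time. -/
lemma exists_complete_cover (hV : Module.finrank F V = 3) (m : ℕ) :
    ∀ (T : Finset V) (a b : V), a ∈ T → b ∈ T → LinearIndependent F ![a, b] →
      (uncovered F T).card ≤ 2 * (Fintype.card F - 1) * m →
      ∃ T' : Finset V, T'.card ≤ T.card + m ∧ T ⊆ T' ∧ uncovered F T' = ∅ := by
  classical
  induction m with
  | zero =>
    intro T a b _ _ _ h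
    exact ⟨T, by simp, subset_rfl, by simpa using h⟩
  | succ m ih =>
    intro T a b ha hb hab hcard
    have hmono : ∀ p, ∀ u ∈ uncovered F (insert p T), u ∈ uncovered F T := by
      intro p u hu
      rw [mem_uncovered] at hu ⊢
      exact ⟨hu.1, fun a ha b hb => hu.2 a (mem_insert_of_mem ha) b (mem_insert_of_mem hb)⟩
    by_cases hne : ∃ v ∈ uncovered F T, ∃ w ∈ uncovered F T, w ∉ Submodule.span F {v}
    · obtain ⟨v, hv, w, hw, hvw⟩ := hne
      obtain ⟨p, hpv, hpw⟩ := exists_vector_covering_two hV ha hb hab hv hw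
      have hv0 := (mem_uncovered.1 hv).1
      have hw0 := (mem_uncovered.1 hw).1
      let P : V → Finset V := fun x => univ.image (fun c : Fˣ => (c : F) • x)
      have hPcard : ∀ x : V, x ≠ 0 → (P x).card = Fintype.card F - 1 := by
        intro x hx
        rw [Finset.card_image_of_injective, card_univ, Fintype.card_units]
        exact fun c d h => Units.ext (smul_left_injective F hx h)
      have hdisj : Disjoint (P v) (P w) := by
        rw [Finset.disjoint_left]
        rintro x hx hx'
        obtain ⟨c, -, rfl⟩ := mem_image.1 hx
        obtain ⟨d, -, h⟩ := mem_image.1 hx'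
        refine hvw (Submodule.mem_span_singleton.2 ⟨(d : F)⁻¹ * c, ?_⟩)
        rw [mul_smul, inv_smul_eq_iff₀ d.ne_zero, h]
      have hPsub : P v ∪ P w ⊆ uncovered F T := by
        intro x hx
        rcases mem_union.1 hx with hx | hx <;> obtain ⟨c, -, rfl⟩ := mem_image.1 hx
        · exact smul_mem_uncovered hv c.ne_zero
        · exact smul_mem_uncovered hw c.ne_zero
      have hsub : uncovered F (insert p T) ⊆ uncovered F T \ (P v ∪ P w) := by
        intro u hu
        refine mem_sdiff.2 ⟨hmono p u hu, fun hx => ?_⟩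
        rw [mem_uncovered] at hu
        rcases mem_union.1 hx with hx | hx <;> obtain ⟨c, -, rfl⟩ := mem_image.1 hx
        · exact hu.2 p (mem_insert_self _ _) a (mem_insert_of_mem ha)
            (Submodule.smul_mem _ _ hpv)
        · exact hu.2 p (mem_insert_self _ _) b (mem_insert_of_mem hb)
            (Submodule.smul_mem _ _ hpw)
      have hle := card_le_card hsub
      rw [card_sdiff_of_subset hPsub, card_union_of_disjoint hdisj, hPcard v hv0,
        hPcard w hw0] at hle
      obtain ⟨T', h1, h2, h3⟩ := ih (insert p T) a b (mem_insert_of_mem ha)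
        (mem_insert_of_mem hb) hab (by rw [mul_add] at hcard; omega)
      exact ⟨T', by have := card_insert_le p T; omega, (subset_insert p T).trans h2, h3⟩
    · push Not at hne
      rcases (uncovered F T).eq_empty_or_nonempty with h | ⟨v, hv⟩
      · exact ⟨T, by omega, subset_rfl, h⟩
      · refine ⟨insert v T, by have := card_insert_le v T; omega, subset_insert v T, ?_⟩
        rw [Finset.eq_empty_iff_forall_notMem]
        intro u hu
        have hmem := hne v hv u (hmono v u hu)
        exact (mem_uncovered.1 hu).2 v (mem_insert_self _ _) v (mem_insert_self _ _)
          (by simpa using hmem)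

end Greedy

section Estimates

lemma one_sub_le_exp_neg_add_sq {x : ℝ} (hx : 0 ≤ x) :
    1 - x ≤ Real.exp (-(x + x ^ 2 / 2)) := by
  rcases lt_or_ge x 1 with h1 | h1
  · have hs := Real.hasSum_pow_div_log_of_abs_lt_one (x := x) (by rwa [abs_of_nonneg hx])
    have hle := sum_le_hasSum (range 2) (fun i _ => by positivity) hs
    norm_num [Finset.sum_range_succ] at hle
    rw [← Real.log_le_iff_le_exp (by linarith)]
    linarith
  · exact (sub_nonpos.2 h1).trans (Real.exp_pos _).le

/-- The exponent in the upper estimate for the number of vectors that the greedy process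
leaves uncovered after `k` steps. -/
noncomputable def greedyExponent (q k : ℝ) : ℝ :=
  k * (k - 1) / (2 * (q + 3)) + (k - 1) * k * (2 * k - 1) / (12 * (q + 3) ^ 2)

lemma greedyExponent_add_one {q : ℝ} (hq : 0 ≤ q) (k : ℝ) :
    greedyExponent q (k + 1) =
      greedyExponent q k + (k / (q + 3) + (k / (q + 3)) ^ 2 / 2) := by
  unfold greedyExponent
  have : q + 3 ≠ 0 := by positivity
  field_simp
  ring

lemma le_greedyExponent {q k L : ℝ} (hq : 79 ≤ q) (hL : 12 ≤ L) (hk : 30 ≤ k)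
    (hkL : (q + 1) * L ≤ k ^ 2) : 1 / (q - 1) + L / 2 ≤ greedyExponent q k := by
  have hq3 : 0 < q + 3 := by linarith
  have h1 : 1 / (q - 1) * (2 * (q + 3)) ≤ 11 / 5 := by
    rw [div_mul_eq_mul_div, div_le_iff₀ (by linarith)]
    linarith
  have h2 : L * (40 / 41) ≤ k ^ 2 / (q + 3) := by
    rw [le_div_iff₀ hq3]
    nlinarith
  have h3 : L * (40 / 41) * (2 * k - 3) ≤ k ^ 2 / (q + 3) * (2 * k - 3) :=
    mul_le_mul_of_nonneg_right h2 (by linarith)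
  have h4 : greedyExponent q k * (2 * (q + 3)) =
      k ^ 2 - k + k ^ 2 / (q + 3) * (2 * k - 3) / 6 + k / (6 * (q + 3)) := by
    unfold greedyExponent
    field_simp
    ring
  have h5 : 0 ≤ k / (6 * (q + 3)) := by positivity
  have h6 : (12 : ℝ) * (40 * k - 306) ≤ L * (40 * k - 306) :=
    mul_le_mul_of_nonneg_right hL (by linarith)
  refine le_of_mul_le_mul_right ?_ (show 0 < 2 * (q + 3) by positivity)
  rw [h4, add_mul]
  nlinarith

lemma four_le_log {q : ℝ} (hq : 79 ≤ q) : 4 ≤ Real.log q := by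
  rw [Real.le_log_iff_exp_le (by linarith)]
  have h : Real.exp 4 = Real.exp 1 ^ 4 := by rw [← Real.exp_nat_mul]; norm_num
  rw [h]
  have := Real.exp_one_lt_d9
  calc Real.exp 1 ^ 4 ≤ 2.7182818286 ^ 4 := by gcongr
    _ ≤ q := le_trans (by norm_num) hq

lemma twelve_le_log_sum {q : ℝ} (hq : 79 ≤ q) :
    12 ≤ 3 * Real.log q + Real.log (Real.log q) + Real.log (3 / 4) := by
  have h4 := four_le_log hq
  have h : 0 ≤ Real.log (Real.log q) + Real.log (3 / 4) := by
    rw [← Real.log_mul (by linarith) (by norm_num)]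
    exact Real.log_nonneg (by linarith)
  linarith

lemma two_mul_sqrt_eq {q : ℝ} (hq : 79 ≤ q) :
    2 * √(q / (3 * Real.log q)) =
      q ^ 2 * Real.exp (-((3 * Real.log q + Real.log (Real.log q) + Real.log (3 / 4)) / 2)) := by
  have h4 := four_le_log hq
  have hq0 : 0 < q := by linarith
  have hl0 : 0 < Real.log q := by linarith
  have hexp : Real.exp (3 * Real.log q + Real.log (Real.log q) + Real.log (3 / 4)) =
      q ^ 3 * Real.log q * (3 / 4) := by
    rw [Real.exp_add, Real.exp_add, Real.exp_log hl0, Real.exp_log (by norm_num),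
      show (3 : ℝ) * Real.log q = (3 : ℕ) * Real.log q by norm_num, Real.exp_nat_mul,
      Real.exp_log hq0]
  rw [← sq_eq_sq₀ (by positivity) (by positivity), mul_pow, mul_pow,
    Real.sq_sqrt (by positivity), ← Real.exp_nat_mul]
  rw [show ((2 : ℕ) : ℝ) * -((3 * Real.log q + Real.log (Real.log q) + Real.log (3 / 4)) / 2) =
    -(3 * Real.log q + Real.log (Real.log q) + Real.log (3 / 4)) by push_cast; ring,
    Real.exp_neg, hexp]
  field_simp
  norm_num

lemma cube_mul_exp_greedyExponent_le {q k : ℝ} (hq : 79 ≤ q)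
    (hk : √((q + 1) * (3 * Real.log q + Real.log (Real.log q) + Real.log (3 / 4))) ≤ k) :
    q ^ 3 * Real.exp (-greedyExponent q k) ≤ 2 * (q - 1) * √(q / (3 * Real.log q)) := by
  set L := 3 * Real.log q + Real.log (Real.log q) + Real.log (3 / 4) with hLdef
  have hL : 12 ≤ L := twelve_le_log_sum hq
  have hk0 : 0 ≤ k := (Real.sqrt_nonneg _).trans hk
  have hkL : (q + 1) * L ≤ k ^ 2 := (Real.sqrt_le_left hk0).1 hk
  have hk30 : 30 ≤ k := by
    by_contra! h
    nlinarith
  have hmain := le_greedyExponent hq hL hk30 hkL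
  have hq1 : 0 < q - 1 := by linarith
  have hq0 : 0 < q := by linarith
  have hfrac : q * Real.exp (-(1 / (q - 1))) ≤ q - 1 := by
    have h := Real.add_one_le_exp (1 / (q - 1))
    have h' : q / (q - 1) ≤ Real.exp (1 / (q - 1)) := by
      refine le_trans (le_of_eq ?_) h
      field_simp
      ring
    rw [Real.exp_neg, ← div_eq_mul_inv, div_le_iff₀ (Real.exp_pos _)]
    rw [div_le_iff₀ hq1] at h'
    linarith
  calc q ^ 3 * Real.exp (-greedyExponent q k)
      ≤ q ^ 3 * Real.exp (-(1 / (q - 1)) + -(L / 2)) := by gcongr; linarith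
    _ = (q * Real.exp (-(1 / (q - 1)))) * (q ^ 2 * Real.exp (-(L / 2))) := by
        rw [Real.exp_add]; ring
    _ ≤ (q - 1) * (q ^ 2 * Real.exp (-(L / 2))) := by gcongr
    _ = 2 * (q - 1) * √(q / (3 * Real.log q)) := by rw [← two_mul_sqrt_eq hq]; ring

end Estimates

section Plane

variable {F V : Type*} [Field F] [Fintype F] [AddCommGroup V] [Module F V] [Fintype V]

lemma exists_greedy_set (hV : Module.finrank F V = 3) (hF : 79 ≤ Fintype.card F) (i : ℕ) :
    ∃ T : Finset V, RepresentsDistinctPoints F T ∧ T.card ≤ i ∧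
      ((uncovered F T).card : ℝ) ≤
        (Fintype.card F : ℝ) ^ 3 * Real.exp (-greedyExponent (Fintype.card F) i) ∧
      (uncovered F T = ∅ ∨ T.card = i) := by
  classical
  have hcardV : Fintype.card V = Fintype.card F ^ 3 := by
    rw [Module.card_eq_pow_finrank (K := F), hV]
  induction i with
  | zero =>
    refine ⟨∅, ⟨by simp, by simp⟩, by simp, ?_, Or.inr rfl⟩
    simp only [greedyExponent, CharP.cast_eq_zero]
    norm_num
    exact_mod_cast hcardV ▸ Finset.card_le_univ (uncovered F (∅ : Finset V))
  | succ i ih =>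
    obtain ⟨T, hT, hTi, hU, hor⟩ := ih
    rcases (uncovered F T).eq_empty_or_nonempty with h | hne
    · exact ⟨T, hT, by omega, by rw [h]; simp; positivity, Or.inl h⟩
    · have hTi' : T.card = i := hor.resolve_left hne.ne_empty
      obtain ⟨p, hp, hpT, hle⟩ := exists_insert_uncovered_le hT hne
      have hcard : (insert p T).card = i + 1 := by rw [card_insert_of_notMem hp, hTi']
      refine ⟨insert p T, hpT, hcard.le, ?_, Or.inr hcard⟩
      rw [hcardV, hTi'] at hle
      set q := Fintype.card F with hqdef
      have hq : (79 : ℝ) ≤ q := by exact_mod_cast hF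
      have hle' : ((uncovered F (insert p T)).card : ℝ) * (q : ℝ) ^ 3 +
          ((uncovered F T).card : ℝ) * (((q : ℝ) - 1) * (i * ((q : ℝ) - 1) + 1)) ≤
          ((uncovered F T).card : ℝ) * (q : ℝ) ^ 3 := by
        rw [← Nat.cast_pred (by omega : 0 < q)]
        exact_mod_cast hle
      set u : ℝ := ((uncovered F T).card : ℝ) with hu
      set u' : ℝ := ((uncovered F (insert p T)).card : ℝ) with hu'
      have hu0 : 0 ≤ u := Nat.cast_nonneg _
      have hi0 : (0 : ℝ) ≤ i := Nat.cast_nonneg _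
      have hrate : (i : ℝ) / (q + 3) * (q : ℝ) ^ 3 ≤
          ((q : ℝ) - 1) * (i * ((q : ℝ) - 1) + 1) := by
        rw [div_mul_eq_mul_div, div_le_iff₀ (by positivity)]
        have hpoly : (q : ℝ) ^ 3 ≤ (q - 1) ^ 2 * (q + 3) := by nlinarith
        have := mul_le_mul_of_nonneg_left hpoly hi0
        nlinarith
      have hstep : u' ≤ u * (1 - i / (q + 3)) := by
        refine le_of_mul_le_mul_right ?_ (show (0 : ℝ) < (q : ℝ) ^ 3 by positivity)
        have := mul_le_mul_of_nonneg_left hrate hu0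
        linarith
      calc u' ≤ u * (1 - i / (q + 3)) := hstep
        _ ≤ u * Real.exp (-((i : ℝ) / (q + 3) + (i / (q + 3)) ^ 2 / 2)) := by
            gcongr
            exact one_sub_le_exp_neg_add_sq (by positivity)
        _ ≤ ((q : ℝ) ^ 3 * Real.exp (-greedyExponent q i)) *
              Real.exp (-((i : ℝ) / (q + 3) + (i / (q + 3)) ^ 2 / 2)) := by gcongr
        _ = (q : ℝ) ^ 3 * Real.exp (-greedyExponent q ((i + 1 : ℕ) : ℝ)) := by
            rw [mul_assoc, ← Real.exp_add, Nat.cast_succ, greedyExponent_add_one (by positivity),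
              ← neg_add]

/-- A three-dimensional space has a small set of vectors whose spans of pairs cover it. -/
lemma exists_plane_cover (hV : Module.finrank F V = 3) (hF : 79 ≤ Fintype.card F) :
    ∃ T : Finset V, uncovered F T = ∅ ∧ (T.card : ℝ) + 1 ≤ Upsilon (Fintype.card F) := by
  set q := Fintype.card F with hqdef
  have hq : (79 : ℝ) ≤ q := by exact_mod_cast hF
  set K := √(((q : ℝ) + 1) * (3 * Real.log q + Real.log (Real.log q) + Real.log (3 / 4)))
    with hK
  set W := √((q : ℝ) / (3 * Real.log q)) with hW
  have hUps : Upsilon q = K + W + 3 := rfl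
  have hK0 : 0 ≤ K := Real.sqrt_nonneg _
  have hW0 : 0 ≤ W := Real.sqrt_nonneg _
  have hk := Nat.ceil_lt_add_one hK0
  have hm := Nat.ceil_lt_add_one hW0
  obtain ⟨T, hT, hTcard, hU, hor⟩ := exists_greedy_set (F := F) (V := V) hV hF ⌈K⌉₊
  rcases hor with h | hcard
  · refine ⟨T, h, ?_⟩
    have : (T.card : ℝ) ≤ ⌈K⌉₊ := by exact_mod_cast hTcard
    linarith
  · have h2 : 1 < T.card := by
      rw [hcard, Nat.lt_ceil, Nat.cast_one, hK, Real.lt_sqrt zero_le_one]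
      nlinarith [twelve_le_log_sum hq]
    obtain ⟨a, ha, b, hb, hab⟩ := Finset.one_lt_card.1 h2
    have hle : (uncovered F T).card ≤ 2 * (q - 1) * ⌈W⌉₊ := by
      have h : ((uncovered F T).card : ℝ) ≤ 2 * ((q : ℝ) - 1) * ⌈W⌉₊ :=
        (hU.trans (cube_mul_exp_greedyExponent_le hq (Nat.le_ceil K))).trans
          (mul_le_mul_of_nonneg_left (Nat.le_ceil W) (by linarith))
      rw [← Nat.cast_pred (by omega : 0 < q)] at h
      exact_mod_cast h
    obtain ⟨T', hT', -, hcov⟩ := exists_complete_cover hV _ T a b ha hb (hT.2 a ha b hb hab) hle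
    refine ⟨T', hcov, ?_⟩
    have h3 : (T'.card : ℝ) ≤ ⌈K⌉₊ + ⌈W⌉₊ := by
      rw [← hcard]
      exact_mod_cast hT'
    linarith

end Plane

section Lifting

/-- Every vector of a finite space is a multiple of one of the representatives of its
projective points. -/
lemma exists_point_representatives (F : Type*) [Field F] [Fintype F] (hF : 3 ≤ Fintype.card F)
    (K : Type*) [AddCommGroup K] [Module F K] [Fintype K] :
    ∃ R : Finset K, 2 * R.card ≤ Fintype.card K ∧ ∀ w : K, w ≠ 0 → ∃ r ∈ R, ∃ c : F, w = c • r := by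
  classical
  have : Finite (Projectivization F K) := Projectivization.finite_of_finite F K
  have := Fintype.ofFinite (Projectivization F K)
  refine ⟨univ.image (fun x : Projectivization F K => x.rep), ?_, fun w hw => ?_⟩
  · have h1 := Projectivization.card' F K
    have h2 := Finset.card_image_le (s := univ) (f := fun x : Projectivization F K => x.rep)
    rw [card_univ] at h2
    simp only [Nat.card_eq_fintype_card] at h1
    have h3 : Fintype.card (Projectivization F K) * 2 ≤
        Fintype.card (Projectivization F K) * (Fintype.card F - 1) :=
      Nat.mul_le_mul_left _ (by omega)
    omega
  · refine ⟨(Projectivization.mk F w hw).rep, mem_image_of_mem _ (mem_univ _), ?_⟩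
    obtain ⟨c, hc⟩ := Projectivization.exists_smul_eq_mk_rep F w hw
    exact ⟨((c⁻¹ : Fˣ) : F), by rw [← hc, Units.smul_def, smul_smul]; simp⟩

/-- A covering set of `V` lifts to a covering set of `V × K × K` for an extension field `K`. -/
lemma exists_lifted_cover {F V K : Type*} [Field F] [Fintype F] [AddCommGroup V] [Module F V] [Fintype V]
    [Field K] [Fintype K] [Algebra F K] (hF : 3 ≤ Fintype.card F)
    {T : Finset V} (hT : uncovered F T = ∅) (hTK : T.card ≤ Fintype.card K) :
    ∃ T' : Finset (V × K × K), uncovered F T' = ∅ ∧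
      T'.card ≤ (T.card + 1) * Fintype.card K := by
  classical
  obtain ⟨R, hRcard, hR⟩ := exists_point_representatives F hF K
  obtain ⟨⟨β, hβ⟩⟩ : Nonempty (T ↪ K) := by
    rw [Function.Embedding.nonempty_iff_card_le]
    simpa using hTK
  let A : Finset (V × K × K) :=
    univ.image (fun z : T × K => ((z.1 : V), z.2, β z.1 * z.2))
  let B : Finset (V × K × K) := R.image (fun r => (0, r, 0))
  let C : Finset (V × K × K) := R.image (fun r => (0, 0, r))
  have hA : ∀ (t : T) (x : K), ((t : V), x, β t * x) ∈ A ∪ B ∪ C := fun t x =>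
    mem_union_left _ (mem_union_left _ (mem_image.2 ⟨(t, x), mem_univ _, rfl⟩))
  have hB : ∀ r ∈ R, ((0, r, 0) : V × K × K) ∈ A ∪ B ∪ C := fun r hr =>
    mem_union_left _ (mem_union_right _ (mem_image_of_mem _ hr))
  have hC : ∀ r ∈ R, ((0, 0, r) : V × K × K) ∈ A ∪ B ∪ C := fun r hr =>
    mem_union_right _ (mem_image_of_mem _ hr)
  refine ⟨A ∪ B ∪ C, ?_, ?_⟩
  swap
  · have h1 : A.card ≤ T.card * Fintype.card K := by
      refine card_image_le.trans ?_
      simp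
    have h2 : B.card ≤ R.card := card_image_le
    have h3 : C.card ≤ R.card := card_image_le
    have h4 := card_union_le (A ∪ B) C
    have h5 := card_union_le A B
    rw [add_mul, one_mul]
    omega
  rw [eq_empty_iff_forall_notMem]
  rintro ⟨x, u, v⟩ hxuv
  obtain ⟨hne, hxuv⟩ := mem_uncovered.1 hxuv
  have hcov : ∀ y ∈ A ∪ B ∪ C, ∀ z ∈ A ∪ B ∪ C, ∀ c d : F,
      c • y + d • z ≠ (x, u, v) := fun y hy z hz c d h =>
    hxuv y hy z hz (Submodule.mem_span_pair.2 ⟨c, d, h⟩)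
  -- representations of `x` through a single member of `T`
  have hsingle : ∀ (t : T) (c : F), c ≠ 0 → x ≠ c • (t : V) := by
    intro t c hc hx
    by_cases hw : v - β t * u = 0
    · refine hcov _ (hA t (c⁻¹ • u)) _ (hA t (c⁻¹ • u)) c 0 ?_
      simp [hx, smul_smul, hc, sub_eq_zero.1 hw]
    · obtain ⟨r, hr, d, hd⟩ := hR _ hw
      refine hcov _ (hA t (c⁻¹ • u)) _ (hC r hr) c d ?_
      simp [hx, smul_smul, hc, ← hd]
  have hx0 : x ≠ 0 := by
    intro hx
    by_cases hu : u = 0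
    · have hv : v ≠ 0 := fun hv => hne (by simp [hx, hu, hv])
      obtain ⟨r, hr, d, hd⟩ := hR _ hv
      exact hcov _ (hC r hr) _ (hC r hr) d 0 (by simp [hx, hu, hd])
    · obtain ⟨r, hr, d, hd⟩ := hR _ hu
      by_cases hv : v = 0
      · exact hcov _ (hB r hr) _ (hB r hr) d 0 (by simp [hx, hv, hd])
      · obtain ⟨s, hs, e, he⟩ := hR _ hv
        exact hcov _ (hB r hr) _ (hC s hs) d e (by simp [hx, he, hd])
  have hxT : ∃ a ∈ T, ∃ b ∈ T, x ∈ Submodule.span F {a, b} := by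
    by_contra! h
    have hmem : x ∈ uncovered F T := mem_uncovered.2 ⟨hx0, h⟩
    simp [hT] at hmem
  obtain ⟨a, ha, b, hb, hab⟩ := hxT
  obtain ⟨c, d, hcd⟩ := Submodule.mem_span_pair.1 hab
  by_cases hc : c = 0
  · have hd : d ≠ 0 := fun hd => hx0 (by simp [← hcd, hc, hd])
    exact hsingle ⟨b, hb⟩ d hd (by simp [← hcd, hc])
  by_cases hd : d = 0
  · exact hsingle ⟨a, ha⟩ c hc (by simp [← hcd, hd])
  by_cases heq : a = b
  · subst heq
    have hsum : c + d ≠ 0 := fun h => hx0 (by rw [← hcd, ← add_smul, h, zero_smul])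
    exact hsingle ⟨a, ha⟩ (c + d) hsum (by simp [← hcd, add_smul])
  have hβab : β ⟨b, hb⟩ - β ⟨a, ha⟩ ≠ 0 := by
    rw [sub_ne_zero]
    intro h
    exact heq (congrArg Subtype.val (hβ h)).symm
  set w := (v - β ⟨a, ha⟩ * u) / (β ⟨b, hb⟩ - β ⟨a, ha⟩) with hw
  refine hcov _ (hA ⟨a, ha⟩ (c⁻¹ • (u - w))) _ (hA ⟨b, hb⟩ (d⁻¹ • w)) c d ?_
  have hwv : β ⟨a, ha⟩ * (u - w) + β ⟨b, hb⟩ * w = v := by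
    have : w * (β ⟨b, hb⟩ - β ⟨a, ha⟩) = v - β ⟨a, ha⟩ * u := div_mul_cancel₀ _ hβab
    linear_combination this
  simp [hcd, smul_smul, hc, hd, hwv]

/-- Covering sets are transported by linear equivalences. -/
lemma uncovered_map_eq_empty {F V W : Type*} [Field F] [AddCommGroup V] [Module F V] [Fintype V]
    [AddCommGroup W] [Module F W] [Fintype W] (e : V ≃ₗ[F] W) {T : Finset V}
    (hT : uncovered F T = ∅) : uncovered F (T.map e.toEquiv.toEmbedding) = ∅ := by
  rw [eq_empty_iff_forall_notMem]
  intro w hw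
  obtain ⟨hw0, hw⟩ := mem_uncovered.1 hw
  have hmem : e.symm w ∈ uncovered F T := by
    refine mem_uncovered.2 ⟨by simpa using hw0, fun a ha b hb h => ?_⟩
    obtain ⟨c, d, hcd⟩ := Submodule.mem_span_pair.1 h
    refine hw (e a) (mem_map.2 ⟨a, ha, rfl⟩) (e b) (mem_map.2 ⟨b, hb, rfl⟩)
      (Submodule.mem_span_pair.2 ⟨c, d, ?_⟩)
    rw [← map_smul, ← map_smul, ← map_add, hcd, e.apply_symm_apply]
  simp [hT] at hmem

/-- The projective points of a covering set of vectors form a saturating set. -/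
lemma exists_saturatingPG_of_cover {F V : Type*} [Field F] [AddCommGroup V] [Module F V] [Fintype V]
    {T : Finset V} (hT : uncovered F T = ∅) :
    ∃ S : Set (Projectivization F V), SaturatingPG S ∧ S.ncard ≤ T.card := by
  classical
  let S : Set (Projectivization F V) := {x | ∃ t ∈ T, ∃ h : t ≠ 0, Projectivization.mk F t h = x}
  have hmem : ∀ t ∈ T, ∀ x : Projectivization F V, ∀ c : F, x.rep = c • t → x ∈ S := by
    intro t ht x c hx
    have ht0 : t ≠ 0 := by
      rintro rfl
      exact x.rep_nonzero (by simpa using hx)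
    refine ⟨t, ht, ht0, ?_⟩
    rw [← x.mk_rep, Projectivization.mk_eq_mk_iff']
    have hc : c ≠ 0 := by
      rintro rfl
      exact x.rep_nonzero (by simpa using hx)
    exact ⟨c⁻¹, by rw [hx, smul_smul, inv_mul_cancel₀ hc, one_smul]⟩
  refine ⟨S, fun x hx => ?_, ?_⟩
  · have hcov : ∃ a ∈ T, ∃ b ∈ T, x.rep ∈ Submodule.span F {a, b} := by
      by_contra! h
      have : x.rep ∈ uncovered F T := mem_uncovered.2 ⟨x.rep_nonzero, h⟩
      simp [hT] at this
    obtain ⟨a, ha, b, hb, hab⟩ := hcov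
    obtain ⟨c, d, hcd⟩ := Submodule.mem_span_pair.1 hab
    have ha0 : a ≠ 0 := by
      rintro rfl
      exact hx (hmem b hb x d (by simpa using hcd.symm))
    have hb0 : b ≠ 0 := by
      rintro rfl
      exact hx (hmem a ha x c (by simpa using hcd.symm))
    obtain ⟨s, hs⟩ := Projectivization.exists_smul_eq_mk_rep F a ha0
    obtain ⟨t, ht⟩ := Projectivization.exists_smul_eq_mk_rep F b hb0
    refine ⟨_, ⟨a, ha, ha0, rfl⟩, _, ⟨b, hb, hb0, rfl⟩, fun heq => ?_, ?_⟩
    · obtain ⟨r, hr⟩ := (Projectivization.mk_eq_mk_iff' F a b ha0 hb0).1 heq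
      refine hx (hmem b hb x (c * r + d) ?_)
      rw [← hcd, ← hr, add_smul, mul_smul]
    · refine Submodule.mem_span_pair.2 ⟨c * ((s⁻¹ : Fˣ) : F), d * ((t⁻¹ : Fˣ) : F), ?_⟩
      rw [← hs, ← ht, Units.smul_def, Units.smul_def, smul_smul, smul_smul, mul_assoc, mul_assoc]
      simpa using hcd
  · let f : {t // t ∈ T ∧ t ≠ 0} → Projectivization F V :=
      fun t => Projectivization.mk F t.1 t.2.2
    have hS : S = Set.range f := by
      ext x
      constructor
      · rintro ⟨t, ht, h0, rfl⟩
        exact ⟨⟨t, ht, h0⟩, rfl⟩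
      · rintro ⟨t, rfl⟩
        exact ⟨t.1, t.2.1, t.2.2, rfl⟩
    have h1 : S.ncard ≤ Fintype.card {t // t ∈ T ∧ t ≠ 0} := by
      rw [hS, ← Set.image_univ, ← Nat.card_eq_fintype_card, ← Set.ncard_univ]
      exact Set.ncard_image_le
    have h2 : Fintype.card {t // t ∈ T ∧ t ≠ 0} ≤ Fintype.card T :=
      Fintype.card_le_of_injective (fun t => ⟨t.1, t.2.1⟩)
        (fun s t h => Subtype.ext (congrArg (fun z : T => z.1) h))
    simpa using h1.trans h2

lemma exists_saturatingPG_card_le (F : Type) [Field F] [Fintype F] (hF : 79 ≤ Fintype.card F)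
    (m : ℕ) (hm : 3 ≤ m) :
    ∃ S : Set (Projectivization F (Fin (3 + 2 * m) → F)), SaturatingPG S ∧
      (S.ncard : ℝ) ≤ Upsilon (Fintype.card F) * (Fintype.card F : ℝ) ^ m := by
  classical
  obtain ⟨p, hp⟩ := CharP.exists F
  have : Fact p.Prime := ⟨CharP.char_is_prime F p⟩
  have : NeZero m := ⟨by omega⟩
  let K := FiniteField.Extension F p m
  have : Fintype K := Fintype.ofFinite K
  have hK : Fintype.card K = Fintype.card F ^ m := by
    simpa only [Nat.card_eq_fintype_card] using FiniteField.natCard_extension F p m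
  obtain ⟨T, hT, hTcard⟩ := exists_plane_cover (F := F) (V := Fin 3 → F) (by simp) hF
  have hTK : T.card ≤ Fintype.card K := by
    refine (Finset.card_le_univ T).trans ?_
    rw [hK, Fintype.card_fun, Fintype.card_fin]
    exact Nat.pow_le_pow_right (by omega) hm
  obtain ⟨T', hT', hcard⟩ := exists_lifted_cover (K := K) (by omega) hT hTK
  have hdim : Module.finrank F ((Fin 3 → F) × K × K) = Module.finrank F (Fin (3 + 2 * m) → F) := by
    have hKdim : Module.finrank F K = m := FiniteField.finrank_extension F p m
    simp only [Module.finrank_prod, Module.finrank_fin_fun, hKdim]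
    ring
  obtain ⟨S, hS, hScard⟩ := exists_saturatingPG_of_cover
    (uncovered_map_eq_empty (LinearEquiv.ofFinrankEq _ _ hdim) hT')
  refine ⟨S, hS, ?_⟩
  rw [Finset.card_map] at hScard
  have h : (S.ncard : ℝ) ≤ ((T.card : ℝ) + 1) * (Fintype.card F : ℝ) ^ m := by
    have := hScard.trans hcard
    rw [hK] at this
    exact_mod_cast this
  exact h.trans (by gcongr)

end Lifting

theorem saturating_set_dim_8_12_bound (q : ℕ) (hq : IsPrimePow q) (hq79 : 79 ≤ q)
    (F : Type) [Field F] [Fintype F] (hF : Fintype.card F = q)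
    (N : ℕ) (hN : N = 8 ∨ N = 12) :
    ∃ S : Set (Projectivization F (Fin (N + 1) → F)), SaturatingPG S ∧
      (S.ncard : ℝ) ≤ Upsilon q * (q : ℝ) ^ ((N - 2) / 2) + 2 * (q : ℝ) ^ ((N - 4) / 2)
        + (q : ℝ) ^ ((N - 6) / 2) + (q : ℝ) ^ ((N - 8) / 2) := by
  subst hF
  rcases hN with rfl | rfl
  · obtain ⟨S, hS, hcard⟩ := exists_saturatingPG_card_le F hq79 3 le_rfl
    refine ⟨S, hS, hcard.trans ?_⟩
    norm_num
    linarith [show (0 : ℝ) ≤ 2 * (Fintype.card F : ℝ) ^ 2 + (Fintype.card F : ℝ) + 1 by positivity]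
  · obtain ⟨S, hS, hcard⟩ := exists_saturatingPG_card_le F hq79 5 (by norm_num)
    refine ⟨S, hS, hcard.trans ?_⟩
    norm_num
    linarith [show (0 : ℝ) ≤ 2 * (Fintype.card F : ℝ) ^ 4 + (Fintype.card F : ℝ) ^ 3 +
      (Fintype.card F : ℝ) ^ 2 by positivity]
end
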